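/- arXiv:2006.02621 — 2 statements merged into one kernel-verified Lean document; each statement's English description precedes it below -/
import Mathlib

section
/- Let θ = απ where α ∈ (0,2) is an irrational real number that is algebraic over ℚ. Then the set of points ξ ∈ 𝔠_θ for which ρ_ξ is faithful — i.e., for every w ∈ F₂ with w ≠ 1 one has w(A_ξ, B_ξ) ≠ ±I — contains a dense G_δ subset of 𝔠_θ. -/
/-- `SL(2,ℝ)`. -/
abbrev SL2R := Matrix.SpecialLinearGroup (Fin 2) ℝ

/-- The free group `F₂` on two generators. -/
abbrev F2 := FreeGroup Bool

/-- The generator `X` of `F₂`. -/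
def Xg : F2 := FreeGroup.of true

/-- The generator `Y` of `F₂`. -/
def Yg : F2 := FreeGroup.of false

/-- For `z > 2`, the unique real `ζ ≥ 1` with `ζ + ζ⁻¹ = z` (junk value `1` otherwise). -/
noncomputable def zetaOf (z : ℝ) : ℝ :=
  if 2 < z then (z + Real.sqrt (z ^ 2 - 4)) / 2 else 1

lemma zetaOf_ne_zero (z : ℝ) : zetaOf z ≠ 0 := by
  unfold zetaOf
  split_ifs with h
  · have h4 : (0:ℝ) ≤ Real.sqrt (z ^ 2 - 4) := Real.sqrt_nonneg _
    have : 0 < (z + Real.sqrt (z ^ 2 - 4)) / 2 := by nlinarith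
    exact ne_of_gt this
  · norm_num

/-- The normal-form matrix `A_ξ = [[x,−1],[1,0]]` as an element of `SL(2,ℝ)`. -/
noncomputable def Amat (x : ℝ) : SL2R :=
  ⟨!![x, -1; 1, 0], by simp [Matrix.det_fin_two_of]⟩

/-- The normal-form matrix `B_ξ = [[0,ζ⁻¹],[−ζ,y]]` as an element of `SL(2,ℝ)`. -/
noncomputable def Bmat (y z : ℝ) : SL2R :=
  ⟨!![0, (zetaOf z)⁻¹; -(zetaOf z), y], by
    simp [Matrix.det_fin_two_of]
    exact inv_mul_cancel₀ (zetaOf_ne_zero z)⟩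

/-- Evaluation of words: the homomorphism `F₂ → SL(2,ℝ)` sending `X ↦ A`, `Y ↦ B`. -/
noncomputable def ev (A B : SL2R) : F2 →* SL2R :=
  FreeGroup.lift (fun b => if b then A else B)

/-- The (lifted) holonomy representation of `ξ = (x,y,z)`: `w ↦ w(A_ξ, B_ξ)`. -/
noncomputable def rho (ξ : ℝ × ℝ × ℝ) : F2 →* SL2R :=
  ev (Amat ξ.1) (Bmat ξ.2.1 ξ.2.2)

/-- The Fricke–Klein space `𝔠_θ`. -/
def FK (θ : ℝ) : Set (ℝ × ℝ × ℝ) :=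
  {p | 2 < p.1 ∧ 2 < p.2.1 ∧ 2 < p.2.2 ∧
    p.1 ^ 2 + p.2.1 ^ 2 + p.2.2 ^ 2 - p.1 * p.2.1 * p.2.2 - 2 = -2 * Real.cos (θ / 2)}

/-- The full Fricke–Klein space `𝔠`. -/
def FKall : Set (ℝ × ℝ × ℝ) :=
  {p | 2 < p.1 ∧ 2 < p.2.1 ∧ 2 < p.2.2 ∧
    -2 < p.1 ^ 2 + p.2.1 ^ 2 + p.2.2 ^ 2 - p.1 * p.2.1 * p.2.2 - 2 ∧
    p.1 ^ 2 + p.2.1 ^ 2 + p.2.2 ^ 2 - p.1 * p.2.1 * p.2.2 - 2 < 2}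

/-- Trace of an element of `SL(2,ℝ)`. -/
noncomputable def trSL (A : SL2R) : ℝ := Matrix.trace (A : Matrix (Fin 2) (Fin 2) ℝ)

open Real Filter Topology

/-- The diagonal matrix `diag(e^l, e^{-l})`. -/
noncomputable def diagExp (l : ℝ) : SL2R :=
  ⟨!![exp l, 0; 0, exp (-l)], by simp [Matrix.det_fin_two_of, ← exp_add]⟩

/-- The unipotent product `[[1,b],[0,1]] * [[1,0],[c,1]]`. -/
def unipProd (b c : ℝ) : SL2R :=
  ⟨!![1 + b * c, b; c, 1], by simp [Matrix.det_fin_two_of]⟩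

/-- Upper right entry of the gluing matrix at length parameter `l`. -/
noncomputable def glueUpper (r l : ℝ) : ℝ := r / (exp (2 * l) - 1)

/-- Lower left entry of the gluing matrix at length parameter `l`. -/
noncomputable def glueLower (r l : ℝ) : ℝ := r / (1 - exp (-(2 * l)))

/-- The gluing matrix: conjugates the first boundary holonomy `diagExp l` to the second one. -/
noncomputable def glue (r l : ℝ) : SL2R := unipProd (glueUpper r l) (glueLower r l)

/-- The representation of the fundamental group of the pair of pants obtained by cutting
along `X`; the generators are sent to the two boundary holonomies. -/
noncomputable def pantsRep (r l : ℝ) : F2 →* SL2R :=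
  ev (diagExp l) (glue r l * diagExp l * (glue r l)⁻¹)

/-- The representation with length parameter `l` and twist parameter `t`. -/
noncomputable def twistRep (r l t : ℝ) : F2 →* SL2R :=
  ev (diagExp l) (glue r l * diagExp t)

/-- The inclusion of the pair of pants group: `X ↦ X`, `Y ↦ Y X Y⁻¹`. -/
def pantsIncl : F2 →* F2 := FreeGroup.lift (fun b => if b then Xg else Yg * Xg * Yg⁻¹)

@[simp] lemma ev_Xg (A B : SL2R) : ev A B Xg = A := by simp [ev, Xg]

@[simp] lemma ev_Yg (A B : SL2R) : ev A B Yg = B := by simp [ev, Yg]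

@[simp] lemma pantsIncl_Xg : pantsIncl Xg = Xg := by simp [pantsIncl, Xg]

@[simp] lemma pantsIncl_Yg : pantsIncl Yg = Yg * Xg * Yg⁻¹ := by
  simp [pantsIncl, Yg]

/-- Induction on `F₂` by multiplication on the left with generators and their inverses. -/
lemma F2.induction_left {P : F2 → Prop} (one : P 1) (hX : ∀ h, P h → P (Xg * h))
    (hX' : ∀ h, P h → P (Xg⁻¹ * h)) (hY : ∀ h, P h → P (Yg * h))
    (hY' : ∀ h, P h → P (Yg⁻¹ * h)) (g : F2) : P g := by
  suffices H : ∀ h, P h → P (g * h) by simpa using H 1 one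
  induction g using FreeGroup.induction_on with
  | C1 => simp
  | of x => cases x; exacts [hY, hX]
  | inv_of x _ => cases x; exacts [hY', hX']
  | mul a b ha hb => intro h hh; rw [mul_assoc]; exact ha _ (hb _ hh)

lemma F2.hom_ext {G : Type*} [Group G] {f g : F2 →* G} (hX : f Xg = g Xg) (hY : f Yg = g Yg) :
    f = g := by
  ext x; cases x; exacts [hY, hX]

lemma diagExp_add (a b : ℝ) : diagExp (a + b) = diagExp a * diagExp b := by
  apply Subtype.ext
  rw [Matrix.SpecialLinearGroup.coe_mul]
  simp [diagExp, exp_add, mul_comm]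

lemma diagExp_zero : diagExp 0 = 1 := by
  ext i j
  fin_cases i <;> fin_cases j <;> simp [diagExp]

lemma diagExp_neg (a : ℝ) : diagExp (-a) = (diagExp a)⁻¹ := by
  rw [eq_inv_iff_mul_eq_one, ← diagExp_add, neg_add_cancel, diagExp_zero]

lemma diagExp_zpow (l : ℝ) (n : ℤ) : diagExp l ^ n = diagExp (n * l) := by
  induction n using Int.induction_on with
  | zero => simp [diagExp_zero]
  | succ n ih => rw [zpow_add_one, ih, ← diagExp_add]; congr 1; push_cast; ring
  | pred n ih => rw [zpow_sub_one, ih, ← diagExp_neg, ← diagExp_add]; congr 1; push_cast; ring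

lemma twistRep_pantsIncl (r l t : ℝ) (g : F2) :
    twistRep r l t (pantsIncl g) = pantsRep r l g := by
  have : (twistRep r l t).comp pantsIncl = pantsRep r l := by
    apply F2.hom_ext
    · simp [twistRep, pantsRep]
    · have h : diagExp t * diagExp l * (diagExp t)⁻¹ = diagExp l := by
        rw [← diagExp_add, add_comm, diagExp_add, mul_inv_cancel_right]
      simp only [twistRep, pantsRep, MonoidHom.comp_apply, pantsIncl_Yg, map_mul, map_inv,
        ev_Xg, ev_Yg, mul_inv_rev]
      nth_rewrite 2 [← h]
      group
  exact DFunLike.congr_fun this g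

lemma matrix_fin_two_congr {R : Type*} {a b c d a' b' c' d' : R} (ha : a = a') (hb : b = b')
    (hc : c = c') (hd : d = d') : !![a, b; c, d] = !![a', b'; c', d'] := by
  rw [ha, hb, hc, hd]

/-- The one-parameter elliptic subgroup that contains the limit of the commutators. -/
noncomputable def elliptic (ψ : ℝ) (hψ : cos ψ ≠ 0) (x : ℝ) : SL2R :=
  ⟨!![cos (x + ψ) / cos ψ, sin x / cos ψ; -sin x / cos ψ, cos (x - ψ) / cos ψ], by
    rw [Matrix.det_fin_two_of]
    field_simp
    rw [cos_add, cos_sub]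
    linear_combination cos ψ ^ 2 * sin_sq_add_cos_sq x - sin x ^ 2 * sin_sq_add_cos_sq ψ⟩

lemma elliptic_add {ψ : ℝ} (hψ : cos ψ ≠ 0) (x y : ℝ) :
    elliptic ψ hψ (x + y) = elliptic ψ hψ x * elliptic ψ hψ y := by
  apply Subtype.ext
  rw [Matrix.SpecialLinearGroup.coe_mul]
  simp only [elliptic, Matrix.mul_fin_two]
  refine matrix_fin_two_congr ?_ ?_ ?_ ?_ <;> field_simp <;> simp only [cos_add, cos_sub, sin_add]
  · linear_combination (-sin x * sin y) * sin_sq_add_cos_sq ψ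
  · ring
  · ring
  · linear_combination (-sin x * sin y) * sin_sq_add_cos_sq ψ

lemma elliptic_zero {ψ : ℝ} (hψ : cos ψ ≠ 0) : elliptic ψ hψ 0 = 1 := by
  apply Subtype.ext
  simp [elliptic, hψ, Matrix.one_fin_two]

lemma elliptic_zpow {ψ : ℝ} (hψ : cos ψ ≠ 0) (x : ℝ) (n : ℤ) :
    elliptic ψ hψ x ^ n = elliptic ψ hψ (n * x) := by
  have hneg : elliptic ψ hψ (-x) = (elliptic ψ hψ x)⁻¹ := by
    rw [eq_inv_iff_mul_eq_one, ← elliptic_add, neg_add_cancel, elliptic_zero]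
  induction n using Int.induction_on with
  | zero => simp [elliptic_zero]
  | succ n ih => rw [zpow_add_one, ih, ← elliptic_add]; congr 1; push_cast; ring
  | pred n ih => rw [zpow_sub_one, ih, ← hneg, ← elliptic_add]; congr 1; push_cast; ring

/-- The limit of the commutators, `[[1 - r², r], [-r, 1]]`. -/
def limitRot (r : ℝ) : SL2R :=
  ⟨!![1 - r ^ 2, r; -r, 1], by rw [Matrix.det_fin_two_of]; ring⟩

lemma limitRot_eq_elliptic {ψ : ℝ} (hψ : cos ψ ≠ 0) :
    limitRot (2 * sin ψ) = elliptic ψ hψ (2 * ψ) := by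
  apply Subtype.ext
  simp only [limitRot, elliptic]
  have h3 : cos (2 * ψ + ψ) = cos ψ * (1 - (2 * sin ψ) ^ 2) := by
    rw [cos_add, cos_two_mul, sin_two_mul, cos_sq']; ring
  rw [h3, sin_two_mul, show 2 * ψ - ψ = ψ by ring]
  refine matrix_fin_two_congr ?_ ?_ ?_ ?_ <;> field_simp

/-- No nonzero power of the limit rotation has a zero entry. -/
def GenericRot (r : ℝ) : Prop :=
  ∀ m : ℤ, m ≠ 0 → ∀ i j, (limitRot r ^ m : SL2R).1 i j ≠ 0

lemma genericRot_of_irrational {α : ℝ} (hα : α ∈ Set.Ioo (0 : ℝ) 2) (hirr : Irrational α) :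
    GenericRot (2 * sin (π * (2 - α) / 4)) := by
  intro m hm i j
  set ψ := π * (2 - α) / 4 with hψdef
  have hpi := pi_pos
  have hψ : cos ψ ≠ 0 := by
    refine (cos_pos_of_mem_Ioo ⟨?_, ?_⟩).ne' <;> nlinarith [hα.1, hα.2]
  have hodd : ∀ k : ℤ, cos ((2 * k + 1) * ψ) ≠ 0 := by
    intro k hk
    obtain ⟨n, hn⟩ := cos_eq_zero_iff.mp hk
    have h1 : (2 * k + 1 : ℝ) * (2 - α) = 2 * (2 * n + 1) := by
      apply mul_left_cancel₀ hpi.ne'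
      rw [hψdef] at hn
      linear_combination 4 * hn
    have h2 : (2 * k + 1 : ℝ) ≠ 0 := by exact_mod_cast (by omega : 2 * k + 1 ≠ 0)
    refine hirr ⟨2 - 2 * (2 * n + 1) / (2 * k + 1), ?_⟩
    push_cast
    field_simp
    linear_combination h1
  have heven : sin (m * (2 * ψ)) ≠ 0 := by
    intro hk
    obtain ⟨n, hn⟩ := sin_eq_zero_iff.mp hk
    have h1 : (m : ℝ) * (2 - α) = 2 * n := by
      apply mul_left_cancel₀ hpi.ne'
      rw [hψdef] at hn
      linear_combination -2 * hn
    have h2 : (m : ℝ) ≠ 0 := by exact_mod_cast hm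
    refine hirr ⟨2 - 2 * n / m, ?_⟩
    push_cast
    field_simp
    linear_combination h1
  rw [limitRot_eq_elliptic hψ, elliptic_zpow]
  have e1 : m * (2 * ψ) + ψ = (2 * (m : ℝ) + 1) * ψ := by ring
  have e2 : m * (2 * ψ) - ψ = (2 * ((m - 1 : ℤ) : ℝ) + 1) * ψ := by push_cast; ring
  fin_cases i <;> fin_cases j
  · simpa [elliptic, e1, hψ] using hodd m
  · simpa [elliptic, hψ] using heven
  · simpa [elliptic, hψ] using heven
  · have := hodd (m - 1)
    rw [← e2] at this
    simpa [elliptic, hψ] using this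

/-- A family of matrices with analytic entries. -/
def EntryAnalyticAt (f : ℝ → SL2R) (x : ℝ) : Prop :=
  ∀ i j, AnalyticAt ℝ (fun y => (f y).1 i j) x

namespace EntryAnalyticAt

variable {f g : ℝ → SL2R} {x : ℝ}

lemma const (A : SL2R) : EntryAnalyticAt (fun _ => A) x := fun _ _ => analyticAt_const

lemma mul (hf : EntryAnalyticAt f x) (hg : EntryAnalyticAt g x) :
    EntryAnalyticAt (fun y => f y * g y) x := by
  intro i j
  simp only [Matrix.SpecialLinearGroup.coe_mul, Matrix.mul_apply, Fin.sum_univ_two]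
  exact ((hf i 0).mul (hg 0 j)).add ((hf i 1).mul (hg 1 j))

lemma inv (hf : EntryAnalyticAt f x) : EntryAnalyticAt (fun y => (f y)⁻¹) x := by
  intro i j
  simp only [Matrix.SpecialLinearGroup.coe_inv, Matrix.adjugate_fin_two]
  fin_cases i <;> fin_cases j
  · simpa using hf 1 1
  · simpa using (hf 0 1).fun_neg
  · simpa using (hf 1 0).fun_neg
  · simpa using hf 0 0

lemma ev (hf : EntryAnalyticAt f x) (hg : EntryAnalyticAt g x) (w : F2) :
    EntryAnalyticAt (fun y => ev (f y) (g y) w) x := by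
  induction w using F2.induction_left with
  | one => simpa using const 1
  | hX w hw => simpa using hf.mul hw
  | hX' w hw => simpa using hf.inv.mul hw
  | hY w hw => simpa using hg.mul hw
  | hY' w hw => simpa using hg.inv.mul hw

end EntryAnalyticAt

lemma entryAnalyticAt_diagExp (x : ℝ) : EntryAnalyticAt diagExp x := by
  intro i j
  fin_cases i <;> fin_cases j <;> simp [diagExp] <;> fun_prop

lemma entryAnalyticAt_glue (r : ℝ) {x : ℝ} (hx : 0 < x) : EntryAnalyticAt (glue r) x := by
  have h1 : exp (2 * x) - 1 ≠ 0 := by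
    have := one_lt_exp_iff.mpr (by linarith : 0 < 2 * x); linarith
  have h2 : 1 - exp (-(2 * x)) ≠ 0 := by
    have := exp_lt_one_iff.mpr (by linarith : -(2 * x) < 0); linarith
  have hu : AnalyticAt ℝ (glueUpper r) x :=
    analyticAt_const.div (by fun_prop) h1
  have hl : AnalyticAt ℝ (glueLower r) x :=
    analyticAt_const.div (by fun_prop) h2
  intro i j
  fin_cases i <;> fin_cases j <;> simp [glue, unipProd]
  · fun_prop
  · exact hu
  · exact hl
  · exact analyticAt_const

lemma entryAnalyticAt_pantsRep (r : ℝ) {x : ℝ} (hx : 0 < x) (g : F2) :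
    EntryAnalyticAt (fun l => pantsRep r l g) x :=
  (entryAnalyticAt_diagExp x).ev
    (((entryAnalyticAt_glue r hx).mul (entryAnalyticAt_diagExp x)).mul
      (entryAnalyticAt_glue r hx).inv) g

lemma entryAnalyticAt_twistRep (r l x : ℝ) (w : F2) :
    EntryAnalyticAt (fun t => twistRep r l t w) x :=
  (EntryAnalyticAt.const _).ev ((EntryAnalyticAt.const _).mul (entryAnalyticAt_diagExp x)) w

/-- An analytic function on a ray which does not vanish near infinity has isolated zeros. -/
lemma eventually_ne_zero_of_eventually_atTop {f : ℝ → ℝ} {s : Set ℝ} (hs : IsPreconnected s)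
    (hs' : ∀ᶠ x in atTop, x ∈ s) (hf : AnalyticOnNhd ℝ f s) (h : ∀ᶠ x in atTop, f x ≠ 0)
    {x : ℝ} (hx : x ∈ s) : ∀ᶠ y in 𝓝[≠] x, f y ≠ 0 := by
  rcases (hf x hx).eventually_eq_zero_or_eventually_ne_zero with h0 | h0
  · obtain ⟨y, hy, hys⟩ := (h.and hs').exists
    exact absurd (hf.eqOn_zero_of_preconnected_of_eventuallyEq_zero hs hx h0 hys) hy
  · exact h0

/-- The boundary holonomy of the one-holed torus in the pair of pants group. -/
def cuff : F2 := Xg * Yg⁻¹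

/-- Alternating products of powers of `cuff` and of `Xg`, with powers of `cuff` at both ends. -/
inductive AltWord : F2 → Prop
  | base {m : ℤ} (hm : m ≠ 0) : AltWord (cuff ^ m)
  | step {m n : ℤ} {g : F2} (hm : m ≠ 0) (hn : n ≠ 0) (hg : AltWord g) :
      AltWord (cuff ^ m * (Xg ^ n * g))

/-- Normal forms in the free product `⟨Xg⟩ * ⟨cuff⟩`. -/
lemma exists_altWord (g : F2) :
    (∃ n : ℤ, g = Xg ^ n) ∨ ∃ (k n : ℤ) (d : F2), AltWord d ∧ g = Xg ^ k * d * Xg ^ n := by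
  set P : F2 → Prop := fun g => (∃ n : ℤ, g = Xg ^ n) ∨
    ∃ (k n : ℤ) (d : F2), AltWord d ∧ g = Xg ^ k * d * Xg ^ n with hP
  have hA : ∀ (j : ℤ) (g : F2), P g → P (Xg ^ j * g) := by
    rintro j g (⟨n, rfl⟩ | ⟨k, n, d, hd, rfl⟩)
    · exact Or.inl ⟨j + n, by rw [zpow_add]⟩
    · exact Or.inr ⟨j + k, n, d, hd, by rw [zpow_add]; group⟩
  have hC : ∀ (j : ℤ) (g : F2), j ≠ 0 → P g → P (cuff ^ j * g) := by
    rintro j g hj (⟨n, rfl⟩ | ⟨k, n, d, hd, rfl⟩)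
    · exact Or.inr ⟨0, n, cuff ^ j, .base hj, by simp⟩
    · by_cases hk : k = 0
      · subst hk
        cases hd with
        | @base m hm =>
          by_cases hjm : j + m = 0
          · refine Or.inl ⟨n, ?_⟩
            rw [zpow_zero, one_mul, ← mul_assoc, ← zpow_add, hjm, zpow_zero, one_mul]
          · exact Or.inr ⟨0, n, _, .base hjm, by rw [zpow_add]; group⟩
        | @step m k' d' hm hk' hd' =>
          by_cases hjm : j + m = 0
          · refine Or.inr ⟨k', n, d', hd', ?_⟩
            rw [zpow_zero, one_mul, ← mul_assoc, ← mul_assoc, ← zpow_add, hjm, zpow_zero, one_mul]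
          · exact Or.inr ⟨0, n, _, .step hjm hk' hd', by rw [zpow_add]; group⟩
      · exact Or.inr ⟨0, n, _, .step hj hk hd, by group⟩
  induction g using F2.induction_left with
  | one => exact Or.inl ⟨0, by simp⟩
  | hX h hh => simpa using hA 1 h hh
  | hX' h hh => simpa using hA (-1) h hh
  | hY h hh =>
    have := hC (-1) _ (by norm_num) (hA 1 h hh)
    simpa [cuff] using this
  | hY' h hh =>
    have := hA (-1) _ (hC 1 h (by norm_num) hh)
    change P _
    simpa only [cuff, zpow_one, zpow_neg, mul_assoc, inv_mul_cancel_left] using this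

lemma coe_diagExp (l : ℝ) : (diagExp l).1 = !![exp l, 0; 0, exp (-l)] := rfl

lemma coe_glue (r l : ℝ) : (glue r l).1 =
    !![1 + glueUpper r l * glueLower r l, glueUpper r l; glueLower r l, 1] := rfl

lemma glueLower_sub_glueUpper (r : ℝ) {l : ℝ} (hl : 0 < l) :
    glueLower r l - glueUpper r l = r := by
  have h1 : exp (2 * l) - 1 ≠ 0 := by
    have := one_lt_exp_iff.mpr (by linarith : 0 < 2 * l); linarith
  have h2 : exp (2 * l) ≠ 0 := (exp_pos _).ne'
  rw [glueLower, glueUpper, exp_neg]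
  field_simp

lemma glueUpper_mul_exp (r : ℝ) {l : ℝ} (hl : 0 < l) :
    glueUpper r l * exp l = glueLower r l * exp (-l) := by
  have h0 : exp l ≠ 0 := (exp_pos _).ne'
  have h1 : exp l ^ 2 - 1 ≠ 0 := by
    have := one_lt_exp_iff.mpr hl; nlinarith
  rw [glueLower, glueUpper, exp_neg, exp_neg, two_mul, exp_add, ← sq]
  field_simp

lemma pantsRep_cuff (r : ℝ) {l : ℝ} (hl : 0 < l) :
    (pantsRep r l cuff).1 =
      !![1 + glueUpper r l * glueLower r l - glueLower r l ^ 2,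
          r * (1 + glueUpper r l * glueLower r l);
        -r, 1 + glueUpper r l * glueLower r l - glueUpper r l ^ 2] := by
  have hr := glueLower_sub_glueUpper r hl
  have hu := glueUpper_mul_exp r hl
  have he : exp l * exp (-l) = 1 := by rw [← exp_add]; simp
  have h : pantsRep r l cuff = diagExp l * glue r l * diagExp (-l) * (glue r l)⁻¹ := by
    simp only [pantsRep, cuff, map_mul, map_inv, ev_Xg, ev_Yg, diagExp_neg]
    group
  rw [h]
  simp only [Matrix.SpecialLinearGroup.coe_mul, Matrix.SpecialLinearGroup.coe_inv, coe_diagExp,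
    coe_glue, Matrix.adjugate_fin_two_of, Matrix.mul_fin_two, neg_neg]
  generalize glueUpper r l = b at *
  generalize glueLower r l = c at *
  subst hr
  generalize exp l = u at *
  generalize exp (-l) = v at *
  refine matrix_fin_two_congr ?_ ?_ ?_ ?_
  · linear_combination (1 + b * c) * he - u * c * hu - c ^ 2 * he
  · linear_combination (-(1 + b * c) * b) * he + (1 + b * c) * u * hu + (1 + b * c) * c * he
  · linear_combination -v * hu + (b - c) * he
  · linear_combination b * v * hu + (1 + b * c - b ^ 2) * he

lemma tendsto_glueUpper (r : ℝ) : Tendsto (glueUpper r) atTop (𝓝 0) := by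
  refine Tendsto.div_atTop tendsto_const_nhds ?_
  exact tendsto_atTop_add_const_right _ _
    (tendsto_exp_atTop.comp (tendsto_id.const_mul_atTop two_pos))

lemma tendsto_exp_neg_mul {c : ℝ} (hc : 0 < c) :
    Tendsto (fun l : ℝ => exp (-(c * l))) atTop (𝓝 0) :=
  tendsto_exp_neg_atTop_nhds_zero.comp (tendsto_id.const_mul_atTop hc)

lemma tendsto_glueLower (r : ℝ) : Tendsto (glueLower r) atTop (𝓝 r) := by
  have h : Tendsto (fun l : ℝ => r / (1 - exp (-(2 * l)))) atTop (𝓝 (r / (1 - 0))) :=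
    tendsto_const_nhds.div (tendsto_const_nhds.sub (tendsto_exp_neg_mul two_pos)) (by norm_num)
  rwa [sub_zero, div_one] at h

lemma tendsto_pantsRep_cuff (r : ℝ) :
    Tendsto (fun l => pantsRep r l cuff) atTop (𝓝 (limitRot r)) := by
  refine tendsto_subtype_rng.mpr ?_
  have hb := tendsto_glueUpper r
  have hc := tendsto_glueLower r
  have hbc := (tendsto_const_nhds (x := (1 : ℝ))).add (hb.mul hc)
  have h : Tendsto (fun l => !![1 + glueUpper r l * glueLower r l - glueLower r l ^ 2,
      r * (1 + glueUpper r l * glueLower r l);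
      -r, 1 + glueUpper r l * glueLower r l - glueUpper r l ^ 2]) atTop (𝓝 (limitRot r).1) := by
    refine tendsto_pi_nhds.mpr fun i => tendsto_pi_nhds.mpr fun j => ?_
    fin_cases i <;> fin_cases j
    · simpa [limitRot] using hbc.sub (hc.pow 2)
    · simpa [limitRot] using hbc.const_mul r
    · simp [limitRot]
    · simpa [limitRot] using hbc.sub (hb.pow 2)
  refine h.congr' ?_
  filter_upwards [eventually_gt_atTop 0] with l hl
  rw [pantsRep_cuff r hl]

lemma tendsto_pantsRep_cuff_zpow (r : ℝ) (m : ℤ) (i j : Fin 2) :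
    Tendsto (fun l => (pantsRep r l (cuff ^ m)).1 i j) atTop
      (𝓝 ((limitRot r ^ m : SL2R).1 i j)) := by
  have h : Tendsto (fun l => pantsRep r l (cuff ^ m)) atTop (𝓝 (limitRot r ^ m)) := by
    simp only [map_zpow]
    exact (tendsto_pantsRep_cuff r).zpow m
  exact tendsto_pi_nhds.mp (tendsto_pi_nhds.mp (tendsto_subtype_rng.mp h) i) j

lemma pantsRep_Xg_zpow (r l : ℝ) (n : ℤ) : pantsRep r l (Xg ^ n) = diagExp (n * l) := by
  rw [map_zpow, pantsRep, ev_Xg, diagExp_zpow]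

/-- The second column of an alternating word has a generic limit direction at infinity. -/
lemma AltWord.exists_tendsto {r : ℝ}
    (hr : GenericRot r) {g : F2} (hg : AltWord g) :
    ∃ (s : ℝ → ℝ) (L : Fin 2 → ℝ), (∀ i, L i ≠ 0) ∧
      ∀ i, Tendsto (fun l => s l * (pantsRep r l g).1 i 1) atTop (𝓝 (L i)) := by
  induction hg with
  | @base m hm =>
    exact ⟨fun _ => 1, fun i => (limitRot r ^ m : SL2R).1 i 1, fun i => hr m hm i 1,
      fun i => by simpa using tendsto_pantsRep_cuff_zpow r m i 1⟩
  | @step m n g hm hn hg ih =>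
    obtain ⟨s, L, hL, hs⟩ := ih
    have key : ∀ l i, (pantsRep r l (cuff ^ m * (Xg ^ n * g))).1 i 1 =
        (pantsRep r l (cuff ^ m)).1 i 0 * (exp (n * l) * (pantsRep r l g).1 0 1) +
        (pantsRep r l (cuff ^ m)).1 i 1 * (exp (-(n * l)) * (pantsRep r l g).1 1 1) := by
      intro l i
      rw [map_mul, map_mul, pantsRep_Xg_zpow]
      simp only [Matrix.SpecialLinearGroup.coe_mul, Matrix.mul_apply, Fin.sum_univ_two, coe_diagExp]
      simp
    have hC := fun i j => tendsto_pantsRep_cuff_zpow r m i j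
    rcases lt_or_gt_of_ne hn with hn | hn
    · have hn' : (0 : ℝ) < -2 * n := by
        have : (n : ℝ) < 0 := by exact_mod_cast hn
        linarith
      refine ⟨fun l => s l * exp (n * l), fun i => (limitRot r ^ m : SL2R).1 i 1 * L 1,
        fun i => mul_ne_zero (hr m hm i 1) (hL 1), fun i => ?_⟩
      have := ((hC i 0).mul ((tendsto_exp_neg_mul hn').mul (hs 0))).add ((hC i 1).mul (hs 1))
      rw [zero_mul, mul_zero, zero_add] at this
      refine this.congr fun l => ?_
      have e1 : exp (-(-2 * n * l)) = exp (n * l) * exp (n * l) := by rw [← exp_add]; ring_nf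
      have e2 : exp (n * l) * exp (-(n * l)) = 1 := by rw [← exp_add]; simp
      rw [key, e1]
      linear_combination (-(pantsRep r l (cuff ^ m)).1 i 1 * (s l * (pantsRep r l g).1 1 1)) * e2
    · have hn' : (0 : ℝ) < 2 * n := by
        have : (0 : ℝ) < n := by exact_mod_cast hn
        linarith
      refine ⟨fun l => s l * exp (-(n * l)), fun i => (limitRot r ^ m : SL2R).1 i 0 * L 0,
        fun i => mul_ne_zero (hr m hm i 0) (hL 0), fun i => ?_⟩
      have := ((hC i 0).mul (hs 0)).add ((hC i 1).mul ((tendsto_exp_neg_mul hn').mul (hs 1)))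
      rw [zero_mul, mul_zero, add_zero] at this
      refine this.congr fun l => ?_
      have e1 : exp (-(2 * n * l)) = exp (-(n * l)) * exp (-(n * l)) := by
        rw [← exp_add]; ring_nf
      have e2 : exp (n * l) * exp (-(n * l)) = 1 := by rw [← exp_add]; simp
      rw [key, e1]
      linear_combination (-(pantsRep r l (cuff ^ m)).1 i 0 * (s l * (pantsRep r l g).1 0 1)) * e2

/-- For generic length, only powers of `Xg` fix the repelling fixed point of `Xg`. -/
lemma eventually_pantsRep_zero_one_ne_zero {r : ℝ}
    (hr : GenericRot r) {g : F2}
    (hg : ∀ n : ℤ, g ≠ Xg ^ n) {x : ℝ} (hx : 0 < x) :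
    ∀ᶠ l in 𝓝[≠] x, (pantsRep r l g).1 0 1 ≠ 0 := by
  refine eventually_ne_zero_of_eventually_atTop (s := Set.Ioi 0) isPreconnected_Ioi
    (eventually_gt_atTop 0) (fun y hy => entryAnalyticAt_pantsRep r hy g 0 1) ?_ hx
  rcases exists_altWord g with ⟨n, rfl⟩ | ⟨k, n, d, hd, rfl⟩
  · exact absurd rfl (hg n)
  · obtain ⟨s, L, hL, hs⟩ := hd.exists_tendsto hr
    filter_upwards [(hs 0).eventually_ne (hL 0)] with l hl
    rw [map_mul, map_mul, pantsRep_Xg_zpow, pantsRep_Xg_zpow]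
    simp only [Matrix.SpecialLinearGroup.coe_mul, Matrix.mul_apply, Fin.sum_univ_two, coe_diagExp]
    simpa using right_ne_zero_of_mul hl

lemma intertwine {f g : F2 →* SL2R} {P : Matrix (Fin 2) (Fin 2) ℝ}
    (hX : (f Xg).1 * P = P * (g Xg).1) (hY : (f Yg).1 * P = P * (g Yg).1) (w : F2) :
    (f w).1 * P = P * (g w).1 := by
  have hmul : ∀ a b, (f a).1 * P = P * (g a).1 → (f b).1 * P = P * (g b).1 →
      (f (a * b)).1 * P = P * (g (a * b)).1 := by
    intro a b ha hb
    rw [map_mul, map_mul, Matrix.SpecialLinearGroup.coe_mul, Matrix.SpecialLinearGroup.coe_mul,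
      mul_assoc, hb, ← mul_assoc, ha, mul_assoc]
  have hinv : ∀ a, (f a).1 * P = P * (g a).1 → (f a⁻¹).1 * P = P * (g a⁻¹).1 := by
    intro a ha
    have h1 : (f a⁻¹).1 * (f a).1 = 1 := by
      rw [← Matrix.SpecialLinearGroup.coe_mul, ← map_mul, inv_mul_cancel, map_one]; rfl
    have h2 : (g a).1 * (g a⁻¹).1 = 1 := by
      rw [← Matrix.SpecialLinearGroup.coe_mul, ← map_mul, mul_inv_cancel, map_one]; rfl
    calc (f a⁻¹).1 * P = (f a⁻¹).1 * (P * (g a).1) * (g a⁻¹).1 := by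
          rw [mul_assoc, mul_assoc, h2, mul_one]
      _ = P * (g a⁻¹).1 := by rw [← ha, ← mul_assoc, h1, one_mul]
  induction w using F2.induction_left with
  | one => simp
  | hX w hw => exact hmul _ _ hX hw
  | hX' w hw => exact hmul _ _ (hinv _ hX) hw
  | hY w hw => exact hmul _ _ hY hw
  | hY' w hw => exact hmul _ _ (hinv _ hY) hw

/-- The involution `X ↦ Y⁻¹`, `Y ↦ X⁻¹` of the pair of pants group, exchanging the two
boundary components that are glued. -/
def cuffSwap : F2 →* F2 := FreeGroup.lift (fun b => if b then Yg⁻¹ else Xg⁻¹)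

@[simp] lemma cuffSwap_Xg : cuffSwap Xg = Yg⁻¹ := by simp [cuffSwap, Xg]

@[simp] lemma cuffSwap_Yg : cuffSwap Yg = Xg⁻¹ := by simp [cuffSwap, Yg]

lemma cuffSwap_cuffSwap (g : F2) : cuffSwap (cuffSwap g) = g := by
  have : cuffSwap.comp cuffSwap = MonoidHom.id F2 := F2.hom_ext (by simp) (by simp)
  exact DFunLike.congr_fun this g

lemma glueLower_ne_zero {r l : ℝ} (hr : r ≠ 0) (hl : 0 < l) : glueLower r l ≠ 0 := by
  refine div_ne_zero hr ?_
  have := exp_lt_one_iff.mpr (by linarith : -(2 * l) < 0)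
  linarith

lemma pantsRep_Yg (r l : ℝ) : pantsRep r l Yg = glue r l * diagExp l * (glue r l)⁻¹ := by
  simp [pantsRep]

lemma pantsRep_Xg (r l : ℝ) : pantsRep r l Xg = diagExp l := by simp [pantsRep]

lemma pantsRep_cuffSwap {r l : ℝ} (hr : r ≠ 0) (hl : 0 < l) {g : F2}
    (h : ((glue r l)⁻¹ * pantsRep r l g * glue r l).1 1 0 = 0) :
    (pantsRep r l (cuffSwap g)).1 0 1 = 0 := by
  have hc : ∀ M, (MulAut.conj (glue r l)⁻¹).toMonoidHom M = (glue r l)⁻¹ * M * glue r l :=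
    fun M => by rw [MulEquiv.coe_toMonoidHom, MulAut.conj_apply, inv_inv]
  have key := intertwine (f := (MulAut.conj (glue r l)⁻¹).toMonoidHom.comp (pantsRep r l))
    (g := (pantsRep r l).comp cuffSwap) (P := !![0, glueUpper r l; -glueLower r l, 0]) ?_ ?_ g
  · have h11 := congr_fun (congr_fun key 1) 1
    simp only [MonoidHom.comp_apply, hc,
      Matrix.mul_apply (N := !![0, glueUpper r l; -glueLower r l, 0]), Fin.sum_univ_two, h,
      Matrix.mul_apply (M := !![0, glueUpper r l; -glueLower r l, 0])] at h11
    simpa [glueLower_ne_zero hr hl] using h11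
  · rw [MonoidHom.comp_apply, MonoidHom.comp_apply, hc]
    simp only [pantsRep_Xg, cuffSwap_Xg, map_inv, pantsRep_Yg, mul_inv_rev, inv_inv, ← diagExp_neg,
      Matrix.SpecialLinearGroup.coe_mul, Matrix.SpecialLinearGroup.coe_inv, coe_diagExp,
      coe_glue, Matrix.adjugate_fin_two_of, Matrix.mul_fin_two]
    refine matrix_fin_two_congr ?_ ?_ ?_ ?_ <;> ring_nf
  · rw [MonoidHom.comp_apply, MonoidHom.comp_apply, hc]
    simp only [pantsRep_Yg, cuffSwap_Yg, map_inv, pantsRep_Xg, ← diagExp_neg]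
    rw [show (glue r l)⁻¹ * (glue r l * diagExp l * (glue r l)⁻¹) * glue r l = diagExp l by group]
    simp only [coe_diagExp, Matrix.mul_fin_two]
    refine matrix_fin_two_congr ?_ ?_ ?_ ?_ <;> ring_nf

lemma conj_Yg_ne_Xg_zpow (g : F2) (n : ℤ) : g * Yg * g⁻¹ ≠ Xg ^ n := by
  intro h
  have := congr_arg
    (FreeGroup.lift (fun b : Bool => Multiplicative.ofAdd (if b then (0 : ℤ) else 1))) h
  simp [Xg, Yg] at this

lemma eventually_conj_glue_ne_zero {r : ℝ}
    (hr : GenericRot r) {x : ℝ} (hx : 0 < x) {g : F2} (hg : ∀ n : ℤ, g ≠ Yg ^ n) :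
    ∀ᶠ l in 𝓝[≠] x, ((glue r l)⁻¹ * pantsRep r l g * glue r l).1 1 0 ≠ 0 := by
  have hr0 : r ≠ 0 := by
    have := hr 1 one_ne_zero 0 1
    rw [zpow_one] at this
    simpa [limitRot] using this
  have hg' : ∀ n : ℤ, cuffSwap g ≠ Xg ^ n := by
    intro n h
    apply hg (-n)
    rw [← cuffSwap_cuffSwap g, h, map_zpow, cuffSwap_Xg, inv_zpow, zpow_neg]
  filter_upwards [eventually_pantsRep_zero_one_ne_zero hr hg' hx,
    nhdsWithin_le_nhds (lt_mem_nhds hx)] with l hl hl0 h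
  exact hl (pantsRep_cuffSwap hr0 hl0 h)

lemma eventually_mul_glue_ne_zero {r : ℝ}
    (hr : GenericRot r) {x : ℝ} (hx : 0 < x) (g : F2) :
    ∀ᶠ l in 𝓝[≠] x, (pantsRep r l g * glue r l).1 0 0 ≠ 0 := by
  filter_upwards [eventually_pantsRep_zero_one_ne_zero hr (conj_Yg_ne_Xg_zpow g) hx] with l hl h
  apply hl
  have e : pantsRep r l (g * Yg * g⁻¹) =
      pantsRep r l g * glue r l * diagExp l * (pantsRep r l g * glue r l)⁻¹ := by
    simp only [map_mul, map_inv, pantsRep_Yg]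
    group
  rw [e]
  generalize pantsRep r l g * glue r l = N at h
  simp only [Matrix.SpecialLinearGroup.coe_mul, Matrix.SpecialLinearGroup.coe_inv,
    Matrix.mul_apply, Fin.sum_univ_two, coe_diagExp, Matrix.adjugate_fin_two]
  simp [h]

lemma eventually_glue_inv_mul_ne_zero {r : ℝ}
    (hr : GenericRot r) {x : ℝ} (hx : 0 < x) (g : F2) :
    ∀ᶠ l in 𝓝[≠] x, ((glue r l)⁻¹ * pantsRep r l g).1 1 1 ≠ 0 := by
  filter_upwards [eventually_mul_glue_ne_zero hr hx g⁻¹] with l hl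
  have e : (glue r l)⁻¹ * pantsRep r l g = (pantsRep r l g⁻¹ * glue r l)⁻¹ := by
    rw [map_inv, mul_inv_rev, inv_inv]
  rw [e, Matrix.SpecialLinearGroup.coe_inv, Matrix.adjugate_fin_two]
  simpa using hl

/-- Words in reduced form with respect to the HNN decomposition of `F₂` over the pair of pants
group; the flag records whether the first letter is `Yg` or its inverse. -/
inductive TwistWord : Bool → F2 → Prop
  | pos_base (g : F2) : TwistWord true (Yg * pantsIncl g)
  | neg_base (g : F2) : TwistWord false (Yg⁻¹ * pantsIncl g)
  | pos_pos (g : F2) {w : F2} (hw : TwistWord true w) : TwistWord true (Yg * (pantsIncl g * w))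
  | pos_neg {g w : F2} (hg : ∀ n : ℤ, g ≠ Xg ^ n) (hw : TwistWord false w) :
      TwistWord true (Yg * (pantsIncl g * w))
  | neg_pos {g w : F2} (hg : ∀ n : ℤ, g ≠ Yg ^ n) (hw : TwistWord true w) :
      TwistWord false (Yg⁻¹ * (pantsIncl g * w))
  | neg_neg (g : F2) {w : F2} (hw : TwistWord false w) :
      TwistWord false (Yg⁻¹ * (pantsIncl g * w))

lemma Yg_mul_pantsIncl_mul (n : ℤ) (h : F2) :
    Yg * (pantsIncl (Xg ^ n) * (Yg⁻¹ * h)) = pantsIncl (Yg ^ n) * h := by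
  simp only [map_zpow, pantsIncl_Xg, pantsIncl_Yg, conj_zpow]
  group

lemma Yg_inv_mul_pantsIncl_mul (n : ℤ) (h : F2) :
    Yg⁻¹ * (pantsIncl (Yg ^ n) * (Yg * h)) = pantsIncl (Xg ^ n) * h := by
  simp only [map_zpow, pantsIncl_Xg, pantsIncl_Yg, conj_zpow]
  group

lemma exists_twistWord (w : F2) :
    (∃ g, w = pantsIncl g) ∨ ∃ g ε v, TwistWord ε v ∧ w = pantsIncl g * v := by
  induction w using F2.induction_left with
  | one => exact Or.inl ⟨1, by simp⟩
  | hX w ih =>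
    rcases ih with ⟨g, rfl⟩ | ⟨g, ε, v, hv, rfl⟩
    · exact Or.inl ⟨Xg * g, by simp⟩
    · exact Or.inr ⟨Xg * g, ε, v, hv, by simp [mul_assoc]⟩
  | hX' w ih =>
    rcases ih with ⟨g, rfl⟩ | ⟨g, ε, v, hv, rfl⟩
    · exact Or.inl ⟨Xg⁻¹ * g, by simp⟩
    · exact Or.inr ⟨Xg⁻¹ * g, ε, v, hv, by simp [mul_assoc]⟩
  | hY w ih =>
    rcases ih with ⟨g, rfl⟩ | ⟨g, ε, v, hv, rfl⟩
    · exact Or.inr ⟨1, true, _, .pos_base g, by simp⟩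
    · by_cases hg : ∀ n : ℤ, g ≠ Xg ^ n
      · cases ε
        · exact Or.inr ⟨1, true, _, .pos_neg hg hv, by simp⟩
        · exact Or.inr ⟨1, true, _, .pos_pos g hv, by simp⟩
      · push Not at hg
        obtain ⟨n, rfl⟩ := hg
        cases hv with
        | neg_base g' => exact Or.inl ⟨Yg ^ n * g', by rw [Yg_mul_pantsIncl_mul, map_mul]⟩
        | @neg_pos g' w hg' hw =>
          exact Or.inr ⟨Yg ^ n * g', _, w, hw, by rw [Yg_mul_pantsIncl_mul, map_mul, mul_assoc]⟩
        | @neg_neg g' w hw =>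
          exact Or.inr ⟨Yg ^ n * g', _, w, hw, by rw [Yg_mul_pantsIncl_mul, map_mul, mul_assoc]⟩
        | pos_base g' => exact Or.inr ⟨1, true, _, .pos_pos (Xg ^ n) (.pos_base g'), by simp⟩
        | pos_pos g' hw => exact Or.inr ⟨1, true, _, .pos_pos (Xg ^ n) (.pos_pos g' hw), by simp⟩
        | pos_neg hg' hw => exact Or.inr ⟨1, true, _, .pos_pos (Xg ^ n) (.pos_neg hg' hw), by simp⟩
  | hY' w ih =>
    rcases ih with ⟨g, rfl⟩ | ⟨g, ε, v, hv, rfl⟩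
    · exact Or.inr ⟨1, false, _, .neg_base g, by simp⟩
    · by_cases hg : ∀ n : ℤ, g ≠ Yg ^ n
      · cases ε
        · exact Or.inr ⟨1, false, _, .neg_neg g hv, by simp⟩
        · exact Or.inr ⟨1, false, _, .neg_pos hg hv, by simp⟩
      · push Not at hg
        obtain ⟨n, rfl⟩ := hg
        cases hv with
        | pos_base g' => exact Or.inl ⟨Xg ^ n * g', by rw [Yg_inv_mul_pantsIncl_mul, map_mul]⟩
        | @pos_neg g' w hg' hw =>
          exact Or.inr ⟨Xg ^ n * g', _, w, hw,
            by rw [Yg_inv_mul_pantsIncl_mul, map_mul, mul_assoc]⟩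
        | @pos_pos g' w hw =>
          exact Or.inr ⟨Xg ^ n * g', _, w, hw,
            by rw [Yg_inv_mul_pantsIncl_mul, map_mul, mul_assoc]⟩
        | neg_base g' => exact Or.inr ⟨1, false, _, .neg_neg (Yg ^ n) (.neg_base g'), by simp⟩
        | neg_neg g' hw => exact Or.inr ⟨1, false, _, .neg_neg (Yg ^ n) (.neg_neg g' hw), by simp⟩
        | neg_pos hg' hw => exact Or.inr ⟨1, false, _, .neg_neg (Yg ^ n) (.neg_pos hg' hw), by simp⟩

/-- The direction onto which a reduced word starting with `Yg` (or its inverse) contracts as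
the twist parameter tends to infinity. -/
noncomputable def limitDir (r l : ℝ) : Bool → Fin 2 → ℝ
  | true => ![(glue r l).1 0 0, (glue r l).1 1 0]
  | false => ![0, 1]

lemma limitDir_ne_zero (r l : ℝ) (ε : Bool) : limitDir r l ε ≠ 0 := by
  intro h
  have h0 := congr_fun h 0
  have h1 := congr_fun h 1
  cases ε
  · simp [limitDir] at h1
  · simp only [limitDir, coe_glue] at h0 h1
    simp at h0 h1
    simp [h1] at h0

/-- Some vector is stretched exponentially by the word `w` towards the limit direction. -/
def Stretches (r l : ℝ) (ε : Bool) (w : F2) : Prop :=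
  ∃ (x : Fin 2 → ℝ) (k c : ℝ), 0 < k ∧ c ≠ 0 ∧
    Tendsto (fun t => exp (-(k * t)) • ((twistRep r l t w).1).mulVec x) atTop
      (𝓝 (c • limitDir r l ε))

lemma twistRep_Yg (r l t : ℝ) : twistRep r l t Yg = glue r l * diagExp t := by simp [twistRep]

lemma twistRep_Yg_inv (r l t : ℝ) :
    twistRep r l t Yg⁻¹ = diagExp (-t) * (glue r l)⁻¹ := by
  simp [twistRep, diagExp_neg]

lemma tendsto_mulVec {ι : Type*} {F : Filter ι} (M : SL2R) {v : ι → Fin 2 → ℝ} {a : Fin 2 → ℝ}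
    (hv : Tendsto v F (𝓝 a)) : Tendsto (fun t => M.1.mulVec (v t)) F (𝓝 (M.1.mulVec a)) :=
  ((Continuous.matrix_mulVec continuous_const continuous_id).tendsto a).comp hv

lemma tendsto_exp_smul_diagExp {k c : ℝ} {v : ℝ → Fin 2 → ℝ} {a : Fin 2 → ℝ}
    (hv : Tendsto (fun t => exp (-(k * t)) • v t) atTop (𝓝 (c • a))) :
    Tendsto (fun t => exp (-((k + 1) * t)) • (diagExp t).1.mulVec (v t)) atTop
      (𝓝 ((c * a 0) • ![1, 0])) := by
  have h0 := tendsto_pi_nhds.mp hv 0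
  have h1 := (tendsto_exp_neg_mul two_pos).mul (tendsto_pi_nhds.mp hv 1)
  refine tendsto_pi_nhds.mpr fun i => ?_
  fin_cases i
  · simp [coe_diagExp, dotProduct, Fin.sum_univ_two] at h0 ⊢
    refine h0.congr fun t => ?_
    rw [← mul_assoc, ← exp_add]
    ring_nf
  · simp [coe_diagExp, dotProduct, Fin.sum_univ_two] at h1 ⊢
    refine h1.congr fun t => ?_
    rw [← mul_assoc, ← mul_assoc, ← exp_add, ← exp_add]
    ring_nf

lemma tendsto_exp_smul_diagExp_neg {k c : ℝ} {v : ℝ → Fin 2 → ℝ} {a : Fin 2 → ℝ}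
    (hv : Tendsto (fun t => exp (-(k * t)) • v t) atTop (𝓝 (c • a))) :
    Tendsto (fun t => exp (-((k + 1) * t)) • (diagExp (-t)).1.mulVec (v t)) atTop
      (𝓝 ((c * a 1) • ![0, 1])) := by
  have h0 := tendsto_pi_nhds.mp hv 1
  have h1 := (tendsto_exp_neg_mul two_pos).mul (tendsto_pi_nhds.mp hv 0)
  refine tendsto_pi_nhds.mpr fun i => ?_
  fin_cases i
  · simp [coe_diagExp, dotProduct, Fin.sum_univ_two] at h1 ⊢
    refine h1.congr fun t => ?_
    rw [← mul_assoc, ← mul_assoc, ← exp_add, ← exp_add]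
    ring_nf
  · simp [coe_diagExp, dotProduct, Fin.sum_univ_two] at h0 ⊢
    refine h0.congr fun t => ?_
    rw [← mul_assoc, ← exp_add]
    ring_nf

lemma stretches_pos_of_tendsto {r l : ℝ} {w : F2} {x a : Fin 2 → ℝ} {k c : ℝ} (hk : 0 ≤ k)
    (hc : c ≠ 0) (h : Tendsto (fun t => exp (-(k * t)) • ((twistRep r l t w).1).mulVec x) atTop
      (𝓝 (c • a))) (ha : a 0 ≠ 0) : Stretches r l true (Yg * w) := by
  refine ⟨x, k + 1, c * a 0, by linarith, mul_ne_zero hc ha, ?_⟩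
  have h' := tendsto_mulVec (glue r l) (tendsto_exp_smul_diagExp h)
  have e : (glue r l).1.mulVec ((c * a 0) • ![1, 0]) = (c * a 0) • limitDir r l true := by
    rw [Matrix.mulVec_smul]
    congr 1
    ext i
    fin_cases i <;> simp [limitDir, Matrix.mulVec, dotProduct, Fin.sum_univ_two]
  rw [e] at h'
  refine h'.congr fun t => ?_
  rw [map_mul, twistRep_Yg, Matrix.SpecialLinearGroup.coe_mul, Matrix.SpecialLinearGroup.coe_mul,
    Matrix.mulVec_smul, Matrix.mulVec_mulVec, Matrix.mulVec_mulVec, mul_assoc]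

lemma stretches_neg_of_tendsto {r l : ℝ} {w : F2} {x a : Fin 2 → ℝ} {k c : ℝ} (hk : 0 ≤ k)
    (hc : c ≠ 0) (h : Tendsto (fun t => exp (-(k * t)) • ((twistRep r l t w).1).mulVec x) atTop
      (𝓝 (c • a))) (ha : ((glue r l)⁻¹.1.mulVec a) 1 ≠ 0) :
    Stretches r l false (Yg⁻¹ * w) := by
  refine ⟨x, k + 1, c * ((glue r l)⁻¹.1.mulVec a) 1, by linarith, mul_ne_zero hc ha, ?_⟩
  have h' := tendsto_mulVec (glue r l)⁻¹ h
  simp only [Matrix.mulVec_smul] at h'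
  refine (tendsto_exp_smul_diagExp_neg h').congr fun t => ?_
  rw [map_mul, twistRep_Yg_inv, Matrix.SpecialLinearGroup.coe_mul,
    Matrix.SpecialLinearGroup.coe_mul, Matrix.mulVec_mulVec, Matrix.mulVec_mulVec, mul_assoc]

lemma Stretches.tendsto_pantsIncl_mul {r l : ℝ} {ε : Bool} {w : F2} (g : F2)
    (h : Stretches r l ε w) : ∃ (x : Fin 2 → ℝ) (k c : ℝ), 0 < k ∧ c ≠ 0 ∧
      Tendsto (fun t => exp (-(k * t)) • ((twistRep r l t (pantsIncl g * w)).1).mulVec x) atTop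
        (𝓝 (c • (pantsRep r l g).1.mulVec (limitDir r l ε))) := by
  obtain ⟨x, k, c, hk, hc, h⟩ := h
  refine ⟨x, k, c, hk, hc, ?_⟩
  have h' := tendsto_mulVec (pantsRep r l g) h
  rw [Matrix.mulVec_smul] at h'
  refine h'.congr fun t => ?_
  rw [map_mul, twistRep_pantsIncl, Matrix.SpecialLinearGroup.coe_mul, Matrix.mulVec_smul,
    Matrix.mulVec_mulVec]

lemma tendsto_pantsIncl (r l : ℝ) (g : F2) (a : Fin 2 → ℝ) :
    Tendsto (fun t => exp (-((0 : ℝ) * t)) •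
      ((twistRep r l t (pantsIncl g)).1).mulVec ((pantsRep r l g)⁻¹.1.mulVec a)) atTop
        (𝓝 ((1 : ℝ) • a)) := by
  refine tendsto_const_nhds.congr fun t => ?_
  rw [twistRep_pantsIncl, Matrix.mulVec_mulVec, ← Matrix.SpecialLinearGroup.coe_mul,
    mul_inv_cancel]
  simp

lemma TwistWord.eventually_stretches {r : ℝ} (hr : GenericRot r) {x : ℝ} (hx : 0 < x)
    {ε : Bool} {w : F2} (hw : TwistWord ε w) : ∀ᶠ l in 𝓝[≠] x, Stretches r l ε w := by
  induction hw with
  | pos_base g =>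
    exact .of_forall fun l => stretches_pos_of_tendsto le_rfl one_ne_zero
      (tendsto_pantsIncl r l g ![1, 0]) (by simp)
  | neg_base g =>
    refine .of_forall fun l => stretches_neg_of_tendsto le_rfl one_ne_zero
      (tendsto_pantsIncl r l g ((glue r l).1.mulVec ![0, 1])) ?_
    rw [Matrix.mulVec_mulVec, ← Matrix.SpecialLinearGroup.coe_mul, inv_mul_cancel]
    simp
  | pos_pos g hw ih =>
    filter_upwards [ih, eventually_mul_glue_ne_zero hr hx g] with l h hg
    obtain ⟨x, k, c, hk, hc, h⟩ := h.tendsto_pantsIncl_mul g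
    refine stretches_pos_of_tendsto hk.le hc h ?_
    simpa [limitDir, Matrix.mulVec, dotProduct, Matrix.mul_apply, Fin.sum_univ_two] using hg
  | @pos_neg g w hg hw ih =>
    filter_upwards [ih, eventually_pantsRep_zero_one_ne_zero hr hg hx] with l h hg
    obtain ⟨x, k, c, hk, hc, h⟩ := h.tendsto_pantsIncl_mul g
    refine stretches_pos_of_tendsto hk.le hc h ?_
    simpa [limitDir, Matrix.mulVec, dotProduct, Fin.sum_univ_two] using hg
  | @neg_pos g w hg hw ih =>
    filter_upwards [ih, eventually_conj_glue_ne_zero hr hx hg] with l h hg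
    obtain ⟨x, k, c, hk, hc, h⟩ := h.tendsto_pantsIncl_mul g
    refine stretches_neg_of_tendsto hk.le hc h ?_
    rw [Matrix.mulVec_mulVec, ← Matrix.SpecialLinearGroup.coe_mul]
    rw [Matrix.SpecialLinearGroup.coe_mul] at hg
    simpa [limitDir, Matrix.mulVec, dotProduct, Matrix.mul_apply, Fin.sum_univ_two] using hg
  | neg_neg g hw ih =>
    filter_upwards [ih, eventually_glue_inv_mul_ne_zero hr hx g] with l h hg
    obtain ⟨x, k, c, hk, hc, h⟩ := h.tendsto_pantsIncl_mul g
    refine stretches_neg_of_tendsto hk.le hc h ?_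
    rw [Matrix.mulVec_mulVec, ← Matrix.SpecialLinearGroup.coe_mul]
    simpa [limitDir, Matrix.mulVec, dotProduct, Fin.sum_univ_two] using hg

lemma Stretches.eventually_ne {r l : ℝ} {ε : Bool} {v : F2} (h : Stretches r l ε v) (g : F2)
    (t₀ : ℝ) : ∀ᶠ t in 𝓝[≠] t₀, (twistRep r l t (pantsIncl g * v)).1 ≠ 1 ∧
      (twistRep r l t (pantsIncl g * v)).1 ≠ -1 := by
  obtain ⟨x, k, c, hk, hc, h⟩ := h.tendsto_pantsIncl_mul g
  set w := pantsIncl g * v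
  have hne : c • (pantsRep r l g).1.mulVec (limitDir r l ε) ≠ 0 := by
    refine smul_ne_zero hc fun h0 => limitDir_ne_zero r l ε ?_
    have := congr_arg (pantsRep r l g)⁻¹.1.mulVec h0
    rwa [Matrix.mulVec_mulVec, ← Matrix.SpecialLinearGroup.coe_mul, inv_mul_cancel,
      Matrix.mulVec_zero, Matrix.SpecialLinearGroup.coe_one, Matrix.one_mulVec] at this
  obtain ⟨i, hi⟩ := Function.ne_iff.mp hne
  have hi' := tendsto_pi_nhds.mp h i
  simp only [Pi.smul_apply, smul_eq_mul] at hi'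
  have hz : Tendsto (fun t => exp (-(k * t)) * x i) atTop (𝓝 0) := by
    simpa using (tendsto_exp_neg_mul hk).mul_const (x i)
  have hF := (hi'.sub hz).mul (hi'.add hz)
  rw [sub_zero, add_zero] at hF
  have hev : ∀ᶠ t in 𝓝[≠] t₀, (((twistRep r l t w).1.mulVec x) i - x i) *
      (((twistRep r l t w).1.mulVec x) i + x i) ≠ 0 := by
    refine eventually_ne_zero_of_eventually_atTop isPreconnected_univ (by simp) (fun t _ => ?_) ?_
      (Set.mem_univ t₀)
    · have ha : AnalyticAt ℝ (fun t => ((twistRep r l t w).1.mulVec x) i) t := by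
        simp only [Matrix.mulVec, dotProduct, Fin.sum_univ_two]
        have := entryAnalyticAt_twistRep r l t w
        exact ((this i 0).mul analyticAt_const).add ((this i 1).mul analyticAt_const)
      exact (ha.sub analyticAt_const).mul (ha.add analyticAt_const)
    · filter_upwards [hF.eventually_ne (mul_ne_zero hi hi)] with t ht h0
      apply ht
      linear_combination exp (-(k * t)) * exp (-(k * t)) * h0
  filter_upwards [hev] with t ht
  constructor <;> intro h1 <;> apply ht <;> rw [h1]
  · rw [Matrix.one_mulVec, sub_self, zero_mul]
  · rw [Matrix.neg_mulVec, Matrix.one_mulVec, Pi.neg_apply, neg_add_cancel, mul_zero]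

lemma diagExp_ne {l : ℝ} (hl : l ≠ 0) : (diagExp l).1 ≠ 1 ∧ (diagExp l).1 ≠ -1 := by
  rw [coe_diagExp]
  constructor <;> intro h
  · exact hl (by simpa using congr_fun₂ h 0 0)
  · have := congr_fun₂ h 0 0
    simp at this
    linarith [exp_pos l]

lemma eventually_twistRep_ne {r : ℝ} (hr : GenericRot r) {w : F2} (hw : w ≠ 1) {l₀ : ℝ}
    (hl₀ : 0 < l₀) (t₀ : ℝ) : ∀ᶠ l in 𝓝[≠] l₀, ∀ᶠ t in 𝓝[≠] t₀,
      (twistRep r l t w).1 ≠ 1 ∧ (twistRep r l t w).1 ≠ -1 := by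
  rcases exists_twistWord w with ⟨g, rfl⟩ | ⟨g, ε, v, hv, rfl⟩
  · simp only [twistRep_pantsIncl, eventually_const]
    by_cases hg : ∀ n : ℤ, g ≠ Xg ^ n
    · filter_upwards [eventually_pantsRep_zero_one_ne_zero hr hg hl₀] with l hl
      constructor <;> intro h <;> apply hl <;> rw [h] <;> simp
    · push Not at hg
      obtain ⟨n, rfl⟩ := hg
      have hn : n ≠ 0 := by
        rintro rfl
        simp at hw
      filter_upwards [nhdsWithin_le_nhds (lt_mem_nhds hl₀)] with l hl
      rw [pantsRep_Xg_zpow]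
      exact diagExp_ne (mul_ne_zero (Int.cast_ne_zero.mpr hn) hl.ne')
  · filter_upwards [hv.eventually_stretches hr hl₀] with l hl
    exact hl.eventually_ne g t₀

/-- The point of the Fricke–Klein space with length parameter `l` and twist parameter `t`: the
traces of the images of `Xg`, `Yg` and `Xg * Yg` under `twistRep`. -/
noncomputable def twistPoint (r l t : ℝ) : ℝ × ℝ × ℝ :=
  (exp l + exp (-l), (1 + glueUpper r l * glueLower r l) * exp t + exp (-t),
    (1 + glueUpper r l * glueLower r l) * exp (t + l) + exp (-(t + l)))

lemma glueUpper_mul_glueLower (r : ℝ) {l : ℝ} (hl : 0 < l) :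
    glueUpper r l * glueLower r l * (exp l - exp (-l)) ^ 2 = r ^ 2 := by
  have huv : exp l * exp (-l) = 1 := by rw [← exp_add, add_neg_cancel, exp_zero]
  have h1 : glueUpper r l * (exp l - exp (-l)) = r * exp (-l) := by
    linear_combination glueUpper_mul_exp r hl + exp (-l) * glueLower_sub_glueUpper r hl
  have h2 : glueLower r l * (exp l - exp (-l)) = r * exp l := by
    linear_combination glueUpper_mul_exp r hl + exp l * glueLower_sub_glueUpper r hl
  linear_combination glueLower r l * (exp l - exp (-l)) * h1 + r * exp (-l) * h2 + r ^ 2 * huv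

lemma twistPoint_equation (r t : ℝ) {l : ℝ} (hl : 0 < l) :
    (twistPoint r l t).1 ^ 2 + (twistPoint r l t).2.1 ^ 2 + (twistPoint r l t).2.2 ^ 2 -
      (twistPoint r l t).1 * (twistPoint r l t).2.1 * (twistPoint r l t).2.2 - 2 = 2 - r ^ 2 := by
  have huv : exp l * exp (-l) = 1 := by rw [← exp_add, add_neg_cancel, exp_zero]
  have het : exp t * exp (-t) = 1 := by rw [← exp_add, add_neg_cancel, exp_zero]
  have h := glueUpper_mul_glueLower r hl
  simp only [twistPoint, neg_add, exp_add]
  set D := glueUpper r l * glueLower r l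
  set u := exp l
  set v := exp (-l)
  set E := exp t
  set e := exp (-t)
  have hv : v = u⁻¹ := eq_inv_of_mul_eq_one_right huv
  have he : e = E⁻¹ := eq_inv_of_mul_eq_one_right het
  have hu : u ≠ 0 := (exp_pos _).ne'
  have hE : E ≠ 0 := (exp_pos _).ne'
  rw [← h, hv, he]
  field_simp
  ring

lemma two_lt_iff_exists_exp {x : ℝ} (hx : 2 < x) : ∃ l, 0 < l ∧ x = exp l + exp (-l) := by
  have hs : 0 < x ^ 2 - 4 := by nlinarith
  set s := √(x ^ 2 - 4)
  have hs2 : s ^ 2 = x ^ 2 - 4 := sq_sqrt hs.le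
  have hs0 : 0 < s := sqrt_pos.mpr hs
  have hu : 1 < (x + s) / 2 := by linarith
  refine ⟨log ((x + s) / 2), log_pos hu, ?_⟩
  rw [exp_neg, exp_log (by linarith)]
  field_simp
  linear_combination -hs2

lemma exists_twistPoint {r x y z : ℝ} (hx : 2 < x) (hy : 2 < y)
    (h : x ^ 2 + y ^ 2 + z ^ 2 - x * y * z - 2 = 2 - r ^ 2) :
    ∃ l t, 0 < l ∧ twistPoint r l t = (x, y, z) := by
  obtain ⟨l, hl, rfl⟩ := two_lt_iff_exists_exp hx
  have huv : exp l * exp (-l) = 1 := by rw [← exp_add, add_neg_cancel, exp_zero]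
  have hD := glueUpper_mul_glueLower r hl
  have hlt : exp (-l) < exp l := exp_lt_exp.mpr (by linarith)
  have hpos : 0 < glueUpper r l * glueLower r l ∨ glueUpper r l * glueLower r l = 0 := by
    refine (lt_or_eq_of_le ?_).imp id Eq.symm
    refine nonneg_of_mul_nonneg_left (b := (exp l - exp (-l)) ^ 2) ?_ ?_
    · rw [hD]; positivity
    · exact pow_pos (sub_pos.mpr hlt) 2
  simp only [twistPoint]
  set D := 1 + glueUpper r l * glueLower r l with hDdef
  have hDpos : 0 < D := by rcases hpos with h | h <;> linarith
  set u := exp l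
  set v := exp (-l)
  have huv0 : u - v ≠ 0 := (sub_pos.mpr hlt).ne'
  obtain ⟨a, ha⟩ : ∃ a, a = (z - y * v) / (u - v) := ⟨_, rfl⟩
  obtain ⟨d, hd⟩ : ∃ d, d = (u * y - z) / (u - v) := ⟨_, rfl⟩
  have hy' : a + d = y := by rw [ha, hd]; field_simp; ring
  have hz' : a * u + d * v = z := by rw [ha, hd]; field_simp; ring
  have had : a * d = D := by
    have h2 : (u - v) ^ 2 ≠ 0 := pow_ne_zero 2 huv0
    apply mul_right_cancel₀ h2
    subst hy' hz'
    rw [hDdef]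
    linear_combination -h - hD + (4 - (a + d) ^ 2) * huv
  have hd0 : 0 < d := by
    by_contra hd0
    have ha0 : 0 < a := by linarith
    nlinarith
  have hEe : exp (-(-log d)) = d := by rw [neg_neg, exp_log hd0]
  have hE : D * exp (-log d) = a := by
    rw [exp_neg, exp_log hd0, ← had]
    field_simp
  refine ⟨l, -log d, hl, ?_⟩
  have e1 : D * exp (-log d + l) = a * u := by rw [exp_add, ← mul_assoc, hE]
  have e2 : exp (-(-log d + l)) = d * v := by rw [neg_add, exp_add, hEe]
  rw [e1, e2, hE, hEe, hy', hz']

lemma zetaOf_add_inv {z : ℝ} (hz : 2 < z) : zetaOf z + (zetaOf z)⁻¹ = z := by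
  have hs : 0 < z ^ 2 - 4 := by nlinarith
  have hs2 := sq_sqrt hs.le
  have h0 := zetaOf_ne_zero z
  have h : zetaOf z = (z + √(z ^ 2 - 4)) / 2 := by rw [zetaOf, if_pos hz]
  field_simp
  rw [h]
  linear_combination hs2 / 4

/-- The matrix of a change of basis that takes the normal form to the pair
`diag(u, u⁻¹)`, `[[a,b],[c,d]]`. -/
def normalFormBasis (u v a b ζ : ℝ) : Matrix (Fin 2) (Fin 2) ℝ :=
  !![u * b, -(u * b * v); ζ - u * a, -(u * (ζ - u * a))]

lemma diag_mul_normalFormBasis {u v : ℝ} (huv : u * v = 1) (a b ζ : ℝ) :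
    !![u, 0; 0, v] * normalFormBasis u v a b ζ =
      normalFormBasis u v a b ζ * !![u + v, -1; 1, 0] := by
  simp only [normalFormBasis, Matrix.mul_fin_two]
  refine matrix_fin_two_congr ?_ ?_ ?_ ?_
  · ring
  · linear_combination (-u * b) * huv
  · ring
  · linear_combination (-(ζ - u * a)) * huv

lemma mul_normalFormBasis {u v a b c d ζ ζ' : ℝ} (huv : u * v = 1) (hdet : a * d - b * c = 1)
    (hζ : ζ * ζ' = 1) (hz : ζ + ζ' = a * u + d * v) :
    !![a, b; c, d] * normalFormBasis u v a b ζ =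
      normalFormBasis u v a b ζ * !![0, ζ'; -ζ, a + d] := by
  obtain rfl : ζ' = a * u + d * v - ζ := by linear_combination hz
  simp only [normalFormBasis, Matrix.mul_fin_two]
  refine matrix_fin_two_congr ?_ ?_ ?_ ?_
  · linear_combination (-b * ζ) * huv
  · ring
  · linear_combination (-u) * hdet + u * hζ - d * ζ * huv
  · linear_combination u * v * hdet + huv - hζ

lemma det_normalFormBasis_ne_zero {u v a b c d ζ ζ' : ℝ} (huv : u * v = 1) (hne : u ≠ v)
    (hdet : a * d - b * c = 1) (hζ : ζ * ζ' = 1) (hz : ζ + ζ' = a * u + d * v) (hb : b ≠ 0)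
    (hc : c ≠ 0) : (normalFormBasis u v a b ζ).det ≠ 0 := by
  have hf : (ζ - u * a) * (ζ - d * v) = b * c := by
    linear_combination ζ * hz - hζ + a * d * huv + hdet
  have hf0 : ζ - u * a ≠ 0 := fun h => mul_ne_zero hb hc (by rw [← hf, h, zero_mul])
  have e : (normalFormBasis u v a b ζ).det = u * b * (ζ - u * a) * (v - u) := by
    rw [normalFormBasis, Matrix.det_fin_two_of]
    ring
  rw [e]
  exact mul_ne_zero (mul_ne_zero (mul_ne_zero (left_ne_zero_of_mul_eq_one huv) hb) hf0)
    (sub_ne_zero.mpr hne.symm)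

lemma rho_Xg (ξ : ℝ × ℝ × ℝ) : (rho ξ Xg).1 = !![ξ.1, -1; 1, 0] := by rw [rho, ev_Xg, Amat]

lemma rho_Yg (ξ : ℝ × ℝ × ℝ) :
    (rho ξ Yg).1 = !![0, (zetaOf ξ.2.2)⁻¹; -(zetaOf ξ.2.2), ξ.2.1] := by rw [rho, ev_Yg, Bmat]

lemma exists_twistRep_mul_eq_mul_rho {r l t : ℝ} (hr : r ≠ 0) (hl : 0 < l)
    (hz : 2 < (twistPoint r l t).2.2) : ∃ Q : Matrix (Fin 2) (Fin 2) ℝ, IsUnit Q.det ∧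
      ∀ w, (twistRep r l t w).1 * Q = Q * (rho (twistPoint r l t) w).1 := by
  have huv : exp l * exp (-l) = 1 := by rw [← exp_add, add_neg_cancel, exp_zero]
  have hne : exp l ≠ exp (-l) := exp_injective.ne (by linarith)
  have het : exp t * exp (-t) = 1 := by rw [← exp_add, add_neg_cancel, exp_zero]
  have hζ := mul_inv_cancel₀ (zetaOf_ne_zero (twistPoint r l t).2.2)
  have hz' := (zetaOf_add_inv hz).trans
    (show (twistPoint r l t).2.2 = (1 + glueUpper r l * glueLower r l) * exp t * exp l +
      exp (-t) * exp (-l) by simp only [twistPoint, neg_add, exp_add, mul_assoc])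
  have hdet : (1 + glueUpper r l * glueLower r l) * exp t * exp (-t) -
      glueUpper r l * exp (-t) * (glueLower r l * exp t) = 1 := by linear_combination het
  have hγ := glueLower_ne_zero hr hl
  have hβ : glueUpper r l ≠ 0 := by
    intro h
    have := glueUpper_mul_exp r hl
    rw [h, zero_mul] at this
    exact mul_ne_zero hγ (exp_pos _).ne' this.symm
  refine ⟨_, (det_normalFormBasis_ne_zero huv hne hdet hζ hz' (mul_ne_zero hβ (exp_pos _).ne')
    (mul_ne_zero hγ (exp_pos _).ne')).isUnit, intertwine ?_ ?_⟩
  · rw [rho_Xg, twistRep, ev_Xg, coe_diagExp]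
    exact diag_mul_normalFormBasis huv _ _ _
  · rw [rho_Yg, twistRep_Yg, Matrix.SpecialLinearGroup.coe_mul, coe_diagExp, coe_glue,
      Matrix.mul_fin_two]
    convert mul_normalFormBasis huv hdet hζ hz' using 3 <;> simp [twistPoint]

lemma rho_twistPoint_ne {r l t : ℝ} (hr : r ≠ 0) (hl : 0 < l)
    (hz : 2 < (twistPoint r l t).2.2) {w : F2}
    (hw : (twistRep r l t w).1 ≠ 1 ∧ (twistRep r l t w).1 ≠ -1) :
    (rho (twistPoint r l t) w).1 ≠ 1 ∧ (rho (twistPoint r l t) w).1 ≠ -1 := by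
  obtain ⟨Q, hQ, h⟩ := exists_twistRep_mul_eq_mul_rho hr hl hz
  have hQ' := (Matrix.isUnit_iff_isUnit_det Q).mpr hQ
  refine ⟨fun h1 => hw.1 ?_, fun h1 => hw.2 ?_⟩ <;> apply hQ'.mul_right_cancel <;>
    rw [h, h1] <;> simp

lemma continuousAt_twistPoint (r : ℝ) {l : ℝ} (hl : 0 < l) (t : ℝ) :
    ContinuousAt (fun p : ℝ × ℝ => twistPoint r p.1 p.2) (l, t) := by
  have h := entryAnalyticAt_glue r hl
  have hU : ContinuousAt (glueUpper r) l := by simpa [coe_glue] using (h 0 1).continuousAt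
  have hL : ContinuousAt (glueLower r) l := by simpa [coe_glue] using (h 1 0).continuousAt
  have hU' : ContinuousAt (fun p : ℝ × ℝ => glueUpper r p.1) (l, t) := hU.comp' continuousAt_fst
  have hL' : ContinuousAt (fun p : ℝ × ℝ => glueLower r p.1) (l, t) := hL.comp' continuousAt_fst
  unfold twistPoint
  fun_prop

lemma continuousAt_zetaOf {z : ℝ} (hz : 2 < z) : ContinuousAt zetaOf z := by
  have h : ContinuousAt (fun z : ℝ => (z + √(z ^ 2 - 4)) / 2) z := by fun_prop
  refine h.congr ?_
  filter_upwards [lt_mem_nhds hz] with y hy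
  rw [zetaOf, if_pos hy]

lemma continuous_rho (θ : ℝ) (w : F2) : Continuous fun ξ : FK θ => rho ξ.1 w := by
  have hA : Continuous fun ξ : FK θ => Amat ξ.1.1 := by
    refine Continuous.subtype_mk (continuous_matrix fun i j => ?_) _
    fin_cases i <;> fin_cases j <;> simp <;> fun_prop
  have hB : Continuous fun ξ : FK θ => Bmat ξ.1.2.1 ξ.1.2.2 := by
    have hζ : Continuous fun ξ : FK θ => zetaOf ξ.1.2.2 :=
      continuous_iff_continuousAt.mpr fun ξ => ContinuousAt.comp (f := fun ξ : FK θ => ξ.1.2.2)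
        (continuousAt_zetaOf ξ.2.2.2.1) (by fun_prop)
    refine Continuous.subtype_mk (continuous_matrix fun i j => ?_) _
    fin_cases i <;> fin_cases j <;> simp <;> fun_prop (disch := intro _; exact zetaOf_ne_zero _)
  induction w using F2.induction_left with
  | one => simpa using continuous_const
  | hX w hw => simpa [rho, Function.comp_def] using continuous_mul.comp (hA.prodMk hw)
  | hX' w hw => simpa [rho, Function.comp_def] using continuous_mul.comp (hA.inv.prodMk hw)
  | hY w hw => simpa [rho, Function.comp_def] using continuous_mul.comp (hB.prodMk hw)
  | hY' w hw => simpa [rho, Function.comp_def] using continuous_mul.comp (hB.inv.prodMk hw)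

/-- The points whose holonomy does not send the word `w` to `±1`. -/
def nontrivialAt (θ : ℝ) (w : F2) : Set (FK θ) :=
  {ξ | (rho ξ.1 w).1 ≠ 1 ∧ (rho ξ.1 w).1 ≠ -1}

lemma isOpen_nontrivialAt (θ : ℝ) (w : F2) : IsOpen (nontrivialAt θ w) := by
  have h : Continuous fun ξ : FK θ => (rho ξ.1 w).1 :=
    continuous_subtype_val.comp (continuous_rho θ w)
  exact (isOpen_ne_fun h continuous_const).inter (isOpen_ne_fun h continuous_const)

lemma two_sub_sq_eq_cos (α : ℝ) :
    2 - (2 * sin (π * (2 - α) / 4)) ^ 2 = -2 * cos (α * π / 2) := by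
  have h : cos (α * π / 2) = -cos (2 * (π * (2 - α) / 4)) := by
    rw [← cos_pi_sub]
    congr 1
    ring
  rw [h, cos_two_mul, cos_sq']
  ring

lemma dense_nontrivialAt {α : ℝ} (hα : α ∈ Set.Ioo (0 : ℝ) 2) (hirr : Irrational α) {w : F2}
    (hw : w ≠ 1) : Dense (nontrivialAt (α * π) w) := by
  have hr := genericRot_of_irrational hα hirr
  have hκ := two_sub_sq_eq_cos α
  set r := 2 * sin (π * (2 - α) / 4)
  have hr0 : r ≠ 0 := by
    have := hr 1 one_ne_zero 0 1
    rwa [zpow_one] at this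
  intro ξ
  obtain ⟨hx, hy, hz, he⟩ := ξ.2
  obtain ⟨l₀, t₀, hl₀, h₀⟩ := exists_twistPoint (r := r) hx hy (he.trans hκ.symm)
  refine mem_closure_iff.mpr fun U hU hU₀ => ?_
  obtain ⟨V, hV, rfl⟩ := isOpen_induced_iff.mp hU
  have hW : V ∩ {p | 2 < p.1 ∧ 2 < p.2.1 ∧ 2 < p.2.2} ∈ 𝓝 (twistPoint r l₀ t₀) := by
    rw [h₀]
    refine (hV.inter ?_).mem_nhds ⟨hU₀, hx, hy, hz⟩
    exact (isOpen_lt continuous_const continuous_fst).inter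
      ((isOpen_lt continuous_const continuous_snd.fst).inter
        (isOpen_lt continuous_const continuous_snd.snd))
  have hev := (continuousAt_twistPoint r hl₀ t₀).eventually_mem hW
  rw [nhds_prod_eq] at hev
  obtain ⟨l, hlV, hlw, hl⟩ := ((hev.curry.filter_mono nhdsWithin_le_nhds).and
    ((eventually_twistRep_ne hr hw hl₀ t₀).and
      (nhdsWithin_le_nhds (lt_mem_nhds hl₀)))).exists
  obtain ⟨t, htV, htw⟩ := ((hlV.filter_mono nhdsWithin_le_nhds).and hlw).exists
  exact ⟨⟨twistPoint r l t, htV.2.1, htV.2.2.1, htV.2.2.2, (twistPoint_equation r t hl).trans hκ⟩,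
    htV.1, rho_twistPoint_ne hr0 hl htV.2.2.2 htw⟩

lemma baireSpace_FK (θ : ℝ) : BaireSpace (FK θ) := by
  have h : IsLocallyClosed (FK θ) := by
    refine ⟨{p | 2 < p.1 ∧ 2 < p.2.1 ∧ 2 < p.2.2}, {p | p.1 ^ 2 + p.2.1 ^ 2 + p.2.2 ^ 2 -
      p.1 * p.2.1 * p.2.2 - 2 = -2 * cos (θ / 2)}, ?_, isClosed_eq (by fun_prop) (by fun_prop), ?_⟩
    · exact (isOpen_lt continuous_const continuous_fst).inter
        ((isOpen_lt continuous_const continuous_snd.fst).inter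
          (isOpen_lt continuous_const continuous_snd.snd))
    · ext p
      simp [FK, and_assoc]
  have := h.locallyCompactSpace
  infer_instance

/-- If `θ = απ` with `α ∈ (0,2)` irrational and algebraic, then the set of
`ξ ∈ 𝔠_θ` with `ρ_ξ` faithful contains a dense `G_δ` subset of `𝔠_θ`. -/
theorem stmt_2 (α : ℝ) (hα : α ∈ Set.Ioo (0:ℝ) 2)
    (hirr : Irrational α) (halg : IsAlgebraic ℚ α) :
    ∃ S : Set ↥(FK (α * Real.pi)), IsGδ S ∧ Dense S ∧
      ∀ ξ ∈ S, ∀ w : F2, w ≠ 1 →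
        ((rho ξ.1 w : Matrix (Fin 2) (Fin 2) ℝ) ≠ 1 ∧
         (rho ξ.1 w : Matrix (Fin 2) (Fin 2) ℝ) ≠ -1) := by
  have := baireSpace_FK (α * Real.pi)
  refine ⟨⋂ w : {w : F2 // w ≠ 1}, nontrivialAt (α * Real.pi) w.1,
    .iInter_of_isOpen fun w => isOpen_nontrivialAt _ _,
    dense_iInter_of_isOpen (fun w => isOpen_nontrivialAt _ _)
      fun w => dense_nontrivialAt hα hirr w.2, fun ξ hξ w hw => ?_⟩
  exact Set.mem_iInter.mp hξ ⟨w, hw⟩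
end

section
/- The set of points ξ ∈ 𝔠 such that for every w ∈ F₂ with w ≠ 1 one has |tr(w(A_ξ, B_ξ))| ≠ 2 contains a dense G_δ subset of 𝔠. (In particular, for such ξ the image of ρ_ξ contains no nontrivial parabolic element and ρ_ξ is faithful.) -/
open Filter Topology Matrix

section LeadingTerm

/-- The normalized generator matrices: with `s = x⁻²`, the representation at `x = y`, `ζ = 2 x²`
sends the letter `ℓ` to a conjugate of `x • scaledLetter s ℓ`, the conjugator not depending
on `ℓ`. -/
noncomputable def scaledLetter (s : ℝ) : Bool × Bool → Matrix (Fin 2) (Fin 2) ℝ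
  | (true, true) => !![1, -1; s, 0]
  | (true, false) => !![0, 1; -s, 1]
  | (false, true) => !![0, s / 2; -2, 1]
  | (false, false) => !![1, -(s / 2); 2, 0]

/-- A vector spanning the range of `scaledLetter 0 ℓ`. -/
def rangeVec : Bool × Bool → Fin 2 → ℝ
  | (true, true) => ![1, 0]
  | (true, false) => ![1, 1]
  | (false, true) => ![0, 1]
  | (false, false) => ![1, 2]

/-- A linear form whose kernel is that of `scaledLetter 0 ℓ`. -/
def kerForm : Bool × Bool → Fin 2 → ℝ
  | (true, true) => ![1, -1]
  | (true, false) => ![0, 1]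
  | (false, true) => ![-2, 1]
  | (false, false) => ![1, 0]

lemma scaledLetter_zero (l : Bool × Bool) :
    scaledLetter 0 l = vecMulVec (rangeVec l) (kerForm l) := by
  rcases l with ⟨_ | _, _ | _⟩ <;> ext i j <;> fin_cases i <;> fin_cases j <;>
    simp [scaledLetter, rangeVec, kerForm, vecMulVec_apply]

lemma kerForm_dotProduct_rangeVec_ne_zero {a b : Bool × Bool} (h : a.1 = b.1 → a.2 = b.2) :
    kerForm a ⬝ᵥ rangeVec b ≠ 0 := by
  rcases a with ⟨_ | _, _ | _⟩ <;> rcases b with ⟨_ | _, _ | _⟩ <;>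
    first
    | exact absurd (h rfl) (by decide)
    | (simp [rangeVec, kerForm, dotProduct]; try norm_num)

lemma exists_prod_scaledLetter_zero (L : List (Bool × Bool)) (a : Bool × Bool)
    (h : FreeGroup.IsReduced (a :: L)) :
    ∃ k : ℝ, k ≠ 0 ∧ ((a :: L).map (scaledLetter 0)).prod =
      k • vecMulVec (rangeVec a) (kerForm ((a :: L).getLast (List.cons_ne_nil _ _))) := by
  induction L generalizing a with
  | nil => exact ⟨1, one_ne_zero, by simp [scaledLetter_zero]⟩
  | cons b L ih =>
    rw [FreeGroup.IsReduced, List.isChain_cons_cons] at h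
    obtain ⟨k, hk, hprod⟩ := ih b h.2
    refine ⟨k * (kerForm a ⬝ᵥ rangeVec b),
      mul_ne_zero hk (kerForm_dotProduct_rangeVec_ne_zero h.1), ?_⟩
    rw [List.map_cons, List.prod_cons, hprod, scaledLetter_zero, mul_smul_comm,
      vecMulVec_mul_vecMulVec, List.getLast_cons_cons, vecMulVec_smul, smul_smul]

lemma trace_prod_scaledLetter_zero_ne_zero {L : List (Bool × Bool)} (hL : L ≠ [])
    (h : FreeGroup.IsCyclicallyReduced L) : ((L.map (scaledLetter 0)).prod).trace ≠ 0 := by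
  obtain ⟨a, L, rfl⟩ := List.exists_cons_of_ne_nil hL
  obtain ⟨k, hk, hprod⟩ := exists_prod_scaledLetter_zero L a h.1
  rw [hprod, trace_smul, trace_vecMulVec, dotProduct_comm, smul_eq_mul]
  refine mul_ne_zero hk (kerForm_dotProduct_rangeVec_ne_zero ?_)
  exact h.2 _ (List.getLast_mem_getLast? _) _ (by simp)

lemma continuous_scaledLetter (l : Bool × Bool) : Continuous fun s => scaledLetter s l := by
  rcases l with ⟨_ | _, _ | _⟩ <;> refine continuous_matrix fun i j => ?_ <;>
    fin_cases i <;> fin_cases j <;> simp [scaledLetter] <;> fun_prop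

lemma continuous_prod_scaledLetter (L : List (Bool × Bool)) :
    Continuous fun s => (L.map (scaledLetter s)).prod :=
  continuous_list_prod L fun l _ => continuous_scaledLetter l

end LeadingTerm

lemma zetaOf_add_inv_s4 {t : ℝ} (ht : 1 < t) : zetaOf (t + t⁻¹) = t := by
  have h0 : 0 < t := by linarith
  have h1 : t * t⁻¹ = 1 := mul_inv_cancel₀ h0.ne'
  have h2 : t⁻¹ < 1 := inv_lt_one_of_one_lt₀ ht
  have h3 : 2 < t + t⁻¹ := by nlinarith
  rw [zetaOf, if_pos h3, show (t + t⁻¹) ^ 2 - 4 = (t - t⁻¹) ^ 2 by linear_combination 4 * h1,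
    Real.sqrt_sq (by linarith)]
  ring

/-- The image of a letter under `rho ξ`. -/
noncomputable def rhoLetter (ξ : ℝ × ℝ × ℝ) (l : Bool × Bool) : Matrix (Fin 2) (Fin 2) ℝ :=
  ((rho ξ (FreeGroup.mk [l]) : SL2R) : Matrix (Fin 2) (Fin 2) ℝ)

lemma rho_mk (ξ : ℝ × ℝ × ℝ) (L : List (Bool × Bool)) :
    ((rho ξ (FreeGroup.mk L) : SL2R) : Matrix (Fin 2) (Fin 2) ℝ) =
      (L.map (rhoLetter ξ)).prod := by
  induction L with
  | nil => simp [← FreeGroup.one_eq_mk]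
  | cons a L ih =>
    rw [List.map_cons, List.prod_cons, ← ih, rhoLetter, ← Matrix.SpecialLinearGroup.coe_mul, ← map_mul,
      FreeGroup.mul_mk, List.singleton_append]

lemma rhoLetter_eq {x : ℝ} (hx : 1 < x) (l : Bool × Bool) :
    rhoLetter (x, x, 2 * x ^ 2 + (2 * x ^ 2)⁻¹) l =
      x • (!![x⁻¹, 0; 0, 1] * scaledLetter (x⁻¹ ^ 2) l * !![x, 0; 0, 1]) := by
  have hx0 : x ≠ 0 := by linarith
  have hz : zetaOf (2 * x ^ 2 + (2 * x ^ 2)⁻¹) = 2 * x ^ 2 := zetaOf_add_inv_s4 (by nlinarith)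
  rcases l with ⟨_ | _, _ | _⟩ <;>
    simp only [rhoLetter, rho, ev, FreeGroup.lift_mk, List.map_cons, List.map_nil,
      List.prod_singleton, cond_true, cond_false, if_true, Bool.false_eq_true, if_false,
      Matrix.SpecialLinearGroup.coe_inv] <;>
    simp only [Amat, Bmat, hz, scaledLetter, adjugate_fin_two_of] <;>
    ext i j <;> fin_cases i <;> fin_cases j <;> simp <;> field_simp

lemma prod_rhoLetter_eq {x : ℝ} (hx : 1 < x) (L : List (Bool × Bool)) :
    (L.map (rhoLetter (x, x, 2 * x ^ 2 + (2 * x ^ 2)⁻¹))).prod =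
      x ^ L.length •
        (!![x⁻¹, 0; 0, 1] * (L.map (scaledLetter (x⁻¹ ^ 2))).prod * !![x, 0; 0, 1]) := by
  have hx0 : x ≠ 0 := by linarith
  have h1 : !![x⁻¹, 0; 0, 1] * !![x, 0; 0, 1] = (1 : Matrix (Fin 2) (Fin 2) ℝ) := by
    simp [hx0, one_fin_two]
  have h2 : !![x, 0; 0, 1] * !![x⁻¹, 0; 0, 1] = (1 : Matrix (Fin 2) (Fin 2) ℝ) := by
    simp [hx0, one_fin_two]
  induction L with
  | nil => simp [h1, -cons_mul]
  | cons a L ih =>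
    rw [List.map_cons, List.prod_cons, ih, rhoLetter_eq hx, List.map_cons, List.prod_cons,
      List.length_cons, smul_mul_smul_comm, pow_succ' x L.length, ← Matrix.mul_assoc, ← Matrix.mul_assoc,
      ← Matrix.mul_assoc, Matrix.mul_assoc _ !![x, 0; 0, 1] !![x⁻¹, 0; 0, 1], h2, Matrix.mul_one]

lemma trace_prod_rhoLetter_eq {x : ℝ} (hx : 1 < x) (L : List (Bool × Bool)) :
    ((L.map (rhoLetter (x, x, 2 * x ^ 2 + (2 * x ^ 2)⁻¹))).prod).trace =
      x ^ L.length * ((L.map (scaledLetter (x⁻¹ ^ 2))).prod).trace := by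
  have hx0 : x ≠ 0 := by linarith
  have h2 : !![x, 0; 0, 1] * !![x⁻¹, 0; 0, 1] = (1 : Matrix (Fin 2) (Fin 2) ℝ) := by
    simp [hx0, one_fin_two]
  rw [prod_rhoLetter_eq hx, trace_smul, trace_mul_cycle, h2, Matrix.one_mul, smul_eq_mul]

lemma exists_two_lt_abs_trSL_rho_of_isCyclicallyReduced {L : List (Bool × Bool)} (hL : L ≠ [])
    (h : FreeGroup.IsCyclicallyReduced L) :
    ∃ ξ : ℝ × ℝ × ℝ, 2 < ξ.2.2 ∧ 2 < |trSL (rho ξ (FreeGroup.mk L))| := by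
  have hlim : Tendsto (fun x : ℝ => x⁻¹ ^ 2) atTop (𝓝 0) := by
    simpa using (tendsto_inv_atTop_zero (𝕜 := ℝ)).pow 2
  have htr : Tendsto (fun x : ℝ => |((L.map (scaledLetter (x⁻¹ ^ 2))).prod).trace|) atTop
      (𝓝 |((L.map (scaledLetter 0)).prod).trace|) :=
    ((continuous_prod_scaledLetter L).matrix_trace.abs.tendsto 0).comp hlim
  have hpow : Tendsto (fun x : ℝ => x ^ L.length) atTop atTop :=
    tendsto_pow_atTop (by simpa using hL)
  have hmul := hpow.atTop_mul_pos
    (abs_pos.2 (trace_prod_scaledLetter_zero_ne_zero hL h)) htr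
  obtain ⟨x, hx1, hx2⟩ := ((eventually_gt_atTop (1 : ℝ)).and
    (hmul.eventually_gt_atTop 2)).exists
  refine ⟨(x, x, 2 * x ^ 2 + (2 * x ^ 2)⁻¹), ?_, ?_⟩
  · have : 0 < (2 * x ^ 2)⁻¹ := by positivity
    simp only
    nlinarith
  · rw [trSL, rho_mk, trace_prod_rhoLetter_eq hx1, abs_mul, abs_of_nonneg (by positivity)]
    exact hx2

lemma trSL_conj (g h : SL2R) : trSL (g * h * g⁻¹) = trSL h := by
  rw [trSL, Matrix.SpecialLinearGroup.coe_mul, trace_mul_comm, ← Matrix.SpecialLinearGroup.coe_mul, ← mul_assoc,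
    inv_mul_cancel, one_mul, trSL]

lemma exists_two_lt_abs_trSL_rho {w : F2} (hw : w ≠ 1) :
    ∃ ξ : ℝ × ℝ × ℝ, 2 < ξ.2.2 ∧ 2 < |trSL (rho ξ w)| := by
  set L := FreeGroup.reduceCyclically w.toWord with hL
  have hconj : w = FreeGroup.mk (FreeGroup.reduceCyclically.conjugator w.toWord) *
      FreeGroup.mk L * (FreeGroup.mk (FreeGroup.reduceCyclically.conjugator w.toWord))⁻¹ := by
    rw [FreeGroup.inv_mk, FreeGroup.mul_mk, FreeGroup.mul_mk,
      FreeGroup.reduceCyclically.conj_conjugator_reduceCyclically, FreeGroup.mk_toWord]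
  have hne : L ≠ [] := by
    intro h0
    rw [h0, ← FreeGroup.one_eq_mk, mul_one, mul_inv_cancel] at hconj
    exact hw hconj
  obtain ⟨ξ, hξ, h2⟩ := exists_two_lt_abs_trSL_rho_of_isCyclicallyReduced hne
    (FreeGroup.reduceCyclically.isCyclicallyReduced FreeGroup.isReduced_toWord)
  refine ⟨ξ, hξ, ?_⟩
  rwa [hconj, map_mul, map_mul, map_inv, trSL_conj]

section Analytic

lemma analyticAt_zetaOf {z : ℝ} (hz : 2 < z) : AnalyticAt ℝ zetaOf z := by
  have h : AnalyticAt ℝ (fun z : ℝ => (z + √(z ^ 2 - 4)) / 2) z := by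
    refine ContDiffAt.analyticAt ?_
    have : z ^ 2 - 4 ≠ 0 := by nlinarith
    fun_prop (disch := assumption)
  refine h.congr ?_
  filter_upwards [lt_mem_nhds hz] with u hu
  rw [zetaOf, if_pos hu]

lemma analyticAt_rho_apply (w : F2) {ξ : ℝ × ℝ × ℝ} (hξ : 2 < ξ.2.2) (i j : Fin 2) :
    AnalyticAt ℝ (fun η => (rho η w : Matrix (Fin 2) (Fin 2) ℝ) i j) ξ := by
  have hz : AnalyticAt ℝ (fun η : ℝ × ℝ × ℝ => zetaOf η.2.2) ξ :=
    (analyticAt_zetaOf hξ).comp (f := fun η : ℝ × ℝ × ℝ => η.2.2)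
      (((ContinuousLinearMap.snd ℝ ℝ ℝ).comp (ContinuousLinearMap.snd ℝ ℝ (ℝ × ℝ))).analyticAt ξ)
  have hz' : AnalyticAt ℝ (fun η : ℝ × ℝ × ℝ => (zetaOf η.2.2)⁻¹) ξ :=
    hz.inv (zetaOf_ne_zero _)
  have hx : AnalyticAt ℝ (fun η : ℝ × ℝ × ℝ => η.1) ξ :=
    (ContinuousLinearMap.fst ℝ ℝ (ℝ × ℝ)).analyticAt ξ
  have hy : AnalyticAt ℝ (fun η : ℝ × ℝ × ℝ => η.2.1) ξ :=
    ((ContinuousLinearMap.fst ℝ ℝ ℝ).comp (ContinuousLinearMap.snd ℝ ℝ (ℝ × ℝ))).analyticAt ξ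
  induction w using FreeGroup.induction_on generalizing i j with
  | C1 => simpa using analyticAt_const
  | of b =>
    cases b <;> fin_cases i <;> fin_cases j <;> simp [rho, ev, Amat, Bmat] <;>
      first | assumption | exact analyticAt_const | exact hz.neg
  | inv_of b ih =>
    simp only [map_inv, Matrix.SpecialLinearGroup.coe_inv, adjugate_fin_two]
    fin_cases i <;> fin_cases j <;> simp <;> first | exact ih _ _ | exact (ih _ _).neg
  | mul u v hu hv =>
    simp only [map_mul, Matrix.SpecialLinearGroup.coe_mul, mul_apply, Fin.sum_univ_two]
    exact ((hu _ _).mul (hv _ _)).add ((hu _ _).mul (hv _ _))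

lemma analyticAt_trSL_rho (w : F2) {ξ : ℝ × ℝ × ℝ} (hξ : 2 < ξ.2.2) :
    AnalyticAt ℝ (fun η => trSL (rho η w)) ξ := by
  simp only [trSL, trace_fin_two]
  exact (analyticAt_rho_apply w hξ 0 0).add (analyticAt_rho_apply w hξ 1 1)

end Analytic

lemma abs_eq_two_iff {t : ℝ} : |t| = 2 ↔ t ^ 2 - 4 = 0 := by
  rw [← sq_abs, sub_eq_zero, show (4 : ℝ) = 2 ^ 2 by norm_num,
    pow_left_inj₀ (abs_nonneg t) two_pos.le two_ne_zero]

lemma not_eventually_abs_trSL_rho_eq_two {w : F2} (hw : w ≠ 1) {ξ : ℝ × ℝ × ℝ} (hξ : 2 < ξ.2.2) :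
    ¬ ∀ᶠ η in 𝓝 ξ, |trSL (rho η w)| = 2 := by
  intro hev
  obtain ⟨η, hη, h2⟩ := exists_two_lt_abs_trSL_rho hw
  have hU : Convex ℝ {p : ℝ × ℝ × ℝ | 2 < p.2.2} :=
    (convex_Ioi (2 : ℝ)).linear_preimage
      ((LinearMap.snd ℝ ℝ ℝ).comp (LinearMap.snd ℝ ℝ (ℝ × ℝ)))
  have hana : AnalyticOnNhd ℝ (fun p => trSL (rho p w) ^ 2 - 4) {p : ℝ × ℝ × ℝ | 2 < p.2.2} :=
    fun p hp => ((analyticAt_trSL_rho w hp).pow 2).sub analyticAt_const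
  have hzero := hana.eqOn_zero_of_preconnected_of_eventuallyEq_zero hU.isPreconnected hξ
    (hev.mono fun p hp => abs_eq_two_iff.1 hp) hη
  exact h2.ne' (abs_eq_two_iff.2 hzero)

lemma isOpen_FKall : IsOpen FKall := by
  refine IsOpen.and ?_ (IsOpen.and ?_ (IsOpen.and ?_ (IsOpen.and ?_ ?_))) <;>
    exact isOpen_lt (by fun_prop) (by fun_prop)

lemma isOpen_abs_trSL_rho_ne_two (w : F2) :
    IsOpen {ξ : ↥FKall | |trSL (rho ξ.1 w)| ≠ 2} := by
  have hc : Continuous fun ξ : ↥FKall => trSL (rho ξ.1 w) :=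
    continuous_iff_continuousAt.2 fun ξ =>
      (analyticAt_trSL_rho w ξ.2.2.2.1).continuousAt.comp continuousAt_subtype_val
  exact isOpen_ne_fun hc.abs continuous_const

lemma dense_abs_trSL_rho_ne_two {w : F2} (hw : w ≠ 1) :
    Dense {ξ : ↥FKall | |trSL (rho ξ.1 w)| ≠ 2} := by
  rw [← compl_compl {ξ : ↥FKall | |trSL (rho ξ.1 w)| ≠ 2}, ← interior_eq_empty_iff_dense_compl,
    Set.eq_empty_iff_forall_notMem]
  intro ξ hξ
  refine not_eventually_abs_trSL_rho_eq_two hw ξ.2.2.2.1 ?_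
  rw [← map_nhds_subtype_coe_eq_nhds ξ.2 (isOpen_FKall.mem_nhds ξ.2), eventually_map]
  filter_upwards [mem_interior_iff_mem_nhds.1 hξ] with η hη
  exact not_not.1 hη

/-- The set of `ξ ∈ 𝔠` such that `|tr w(A_ξ,B_ξ)| ≠ 2` for all `w ≠ 1`
contains a dense `G_δ` subset of `𝔠`. -/
theorem stmt_4 :
    ∃ S : Set ↥FKall, IsGδ S ∧ Dense S ∧
      ∀ ξ ∈ S, ∀ w : F2, w ≠ 1 → |trSL (rho ξ.1 w)| ≠ 2 := by
  have : BaireSpace ↥FKall := isOpen_FKall.baireSpace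
  have : Countable F2 := FreeGroup.toWord_injective.countable
  refine ⟨⋂ w : {w : F2 // w ≠ 1}, {ξ | |trSL (rho ξ.1 w)| ≠ 2},
    .iInter_of_isOpen fun w => isOpen_abs_trSL_rho_ne_two w,
    dense_iInter_of_isOpen (fun w => isOpen_abs_trSL_rho_ne_two w)
      fun w => dense_abs_trSL_rho_ne_two w.2, fun ξ hξ w hw => ?_⟩
  exact Set.mem_iInter.1 hξ ⟨w, hw⟩
end
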